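/- arXiv:2312.05914 — 2 statements merged into one kernel-verified Lean document; each statement's English description precedes it below -/
import Mathlib

section
/- Let R be a commutative Noetherian local ring, C a semidualizing R-module, and M a finitely generated R-module such that Hom_R(M,R) has finite C-injective dimension. If Ext_R^i(M,R) = 0 and Ext_R^i(M,M) = 0 for all i ≥ 1, then M is free. (That is, the Auslander-Reiten conjecture holds for finitely generated R-modules M with I_C-id_R(Hom_R(M,R)) < ∞.) -/
open CategoryTheory

noncomputable section

/-- The `i`-th Ext module of two `R`-modules. -/
def extMod (R : Type) [CommRing R] (i : ℕ) (M N : Type) [AddCommGroup M] [Module R M]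
    [AddCommGroup N] [Module R N] : ModuleCat R :=
  ((Ext R (ModuleCat R) i).obj (Opposite.op (ModuleCat.of R M))).obj (ModuleCat.of R N)

/-- The `i`-th Tor module of two `R`-modules. -/
def torMod (R : Type) [CommRing R] (i : ℕ) (M N : Type) [AddCommGroup M] [Module R M]
    [AddCommGroup N] [Module R N] : ModuleCat R :=
  ((Tor (ModuleCat R) i).obj (ModuleCat.of R M)).obj (ModuleCat.of R N)

/-- The depth of a module over a local ring: the infimum of the set of
indices `i` with `Ext^i(R/𝔪, N) ≠ 0`. -/
def moduleDepth (R : Type) [CommRing R] [IsLocalRing R] (N : Type) [AddCommGroup N]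
    [Module R N] : ℕ :=
  sInf {i : ℕ | ¬ Subsingleton (extMod R i (R ⧸ IsLocalRing.maximalIdeal R) N)}

/-- An `R`-module `N` has finite injective dimension iff there is an `n` such that
`Ext^i(M, N) = 0` for all modules `M` and all `i > n`. -/
def HasFiniteInjDim (R : Type) [CommRing R] (N : Type) [AddCommGroup N] [Module R N] : Prop :=
  ∃ n : ℕ, ∀ (M : Type) [AddCommGroup M] [Module R M], ∀ i : ℕ, n < i →
    Subsingleton (extMod R i M N)

/-- An `R`-module `M` has finite projective dimension iff there is an `n` such that
`Ext^i(M, N) = 0` for all modules `N` and all `i > n`. -/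
def HasFiniteProjDim (R : Type) [CommRing R] (M : Type) [AddCommGroup M] [Module R M] : Prop :=
  ∃ n : ℕ, ∀ (N : Type) [AddCommGroup N] [Module R N], ∀ i : ℕ, n < i →
    Subsingleton (extMod R i M N)

/-- The `𝔪`-torsion submodule `Γ_𝔪(M)` of a module over a local ring. -/
def mTorsion (R : Type) [CommRing R] [IsLocalRing R] (M : Type) [AddCommGroup M]
    [Module R M] : Submodule R M :=
  ⨆ n : ℕ, Submodule.torsionBySet R M ((IsLocalRing.maximalIdeal R ^ n : Ideal R) : Set R)

/-- A semidualizing module: the natural map `R → Hom(C,C)` is bijective and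
`Ext^i(C,C) = 0` for all `i ≥ 1`. -/
structure IsSemidualizing (R : Type) [CommRing R] (C : Type) [AddCommGroup C]
    [Module R C] : Prop where
  bijective : Function.Bijective (LinearMap.lsmul R C)
  ext_vanish : ∀ i : ℕ, 1 ≤ i → Subsingleton (extMod R i C C)

/-- Membership in the Auslander class `A_C(R)`: the natural map `M → Hom(C, C ⊗ M)` is
bijective, `Tor_i(C, M) = 0` and `Ext^i(C, C ⊗ M) = 0` for all `i ≥ 1`. -/
structure MemAuslanderClass (R : Type) [CommRing R] (C : Type) [AddCommGroup C] [Module R C]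
    (M : Type) [AddCommGroup M] [Module R M] : Prop where
  bijective : Function.Bijective ((TensorProduct.mk R C M).flip)
  tor_vanish : ∀ i : ℕ, 1 ≤ i → Subsingleton (torMod R i C M)
  ext_vanish : ∀ i : ℕ, 1 ≤ i → Subsingleton (extMod R i C (TensorProduct R C M))

/-- A module `N` is Tor-rigid if for every finitely generated module `M` and every `i ≥ 1`,
`Tor_i(M, N) = 0` implies `Tor_{i+1}(M, N) = 0`. -/
def IsTorRigid (R : Type) [CommRing R] (N : Type) [AddCommGroup N] [Module R N] : Prop :=
  ∀ (M : Type) [AddCommGroup M] [Module R M], Module.Finite R M →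
    ∀ i : ℕ, 1 ≤ i → Subsingleton (torMod R i M N) → Subsingleton (torMod R (i + 1) M N)

/-- The natural map `C ⊗ Hom(M,N) → Hom(M, C ⊗ N)`, sending `c ⊗ φ` to `m ↦ c ⊗ φ m`. -/
def homTensorMap (R : Type) [CommRing R] (C M N : Type) [AddCommGroup C] [Module R C]
    [AddCommGroup M] [Module R M] [AddCommGroup N] [Module R N] :
    TensorProduct R C (M →ₗ[R] N) →ₗ[R] (M →ₗ[R] TensorProduct R C N) :=
  TensorProduct.lift
    ((LinearMap.llcomp R M N (TensorProduct R C N)).comp (TensorProduct.mk R C N))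

open Abelian IsLocalRing TensorProduct

/-- The `Ext` group of two modules in the derived-category sense. -/
abbrev ModExt (R : Type) [CommRing R] (A B : Type) [AddCommGroup A] [Module R A]
    [AddCommGroup B] [Module R B] (i : ℕ) : Type :=
  Abelian.Ext.{0} (ModuleCat.of R A) (ModuleCat.of R B) i

theorem subsingleton_extMod_iff (R : Type) [CommRing R] (A B : Type) [AddCommGroup A]
    [Module R A] [AddCommGroup B] [Module R B] (i : ℕ) (hi : 1 ≤ i) :
    Subsingleton (extMod R i A B) ↔ Subsingleton (ModExt R A B i) := by
  obtain ⟨p, rfl⟩ : ∃ p, i = p + 1 := ⟨i - 1, by omega⟩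
  let P := projectiveResolution (ModuleCat.of R A)
  have h1 : Subsingleton (extMod R (p + 1) A B) ↔
      (P.complex.linearYonedaObj R (ModuleCat.of R B)).ExactAt (p + 1) := by
    rw [HomologicalComplex.exactAt_iff_isZero_homology, ModuleCat.isZero_iff_subsingleton]
    exact (P.isoExt (p + 1) (ModuleCat.of R B)).toLinearEquiv.toEquiv.subsingleton_congr
  rw [h1, HomologicalComplex.exactAt_iff' _ p (p + 1) (p + 2) (by simp) (by simp),
    ShortComplex.moduleCat_exact_iff]
  constructor
  · intro h
    refine subsingleton_of_forall_eq 0 fun x ↦ ?_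
    obtain ⟨f, hf, rfl⟩ := P.extMk_surjective x (p + 2) rfl
    rw [P.extMk_eq_zero_iff _ _ _ _ p rfl]
    exact h f hf
  · intro h f hf
    exact (P.extMk_eq_zero_iff f (p + 2) rfl hf p rfl).1 (Subsingleton.elim _ _)

section LongExact

variable {R : Type} [CommRing R] {A B D : Type} [AddCommGroup A] [Module R A]
  [AddCommGroup B] [Module R B] [AddCommGroup D] [Module R D] (L : Type) [AddCommGroup L]
  [Module R L] {f : A →ₗ[R] B} {g : B →ₗ[R] D}

theorem shortExact_of_linearMap (hf : Function.Injective f) (hfg : Function.Exact f g)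
    (hg : Function.Surjective g) :
    (ModuleCat.shortComplexOfCompEqZero f g hfg.linearMap_comp_eq_zero).ShortExact :=
  ModuleCat.shortComplex_shortExact _ hfg hf hg

theorem subsingleton_ext_right_of_covariant (hf : Function.Injective f)
    (hfg : Function.Exact f g)
    (hg : Function.Surjective g) (i : ℕ) (hB : Subsingleton (ModExt R L B i))
    (hA : Subsingleton (ModExt R L A (i + 1))) : Subsingleton (ModExt R L D i) := by
  refine subsingleton_of_forall_eq 0 fun x ↦ ?_
  obtain ⟨y, rfl⟩ := Ext.covariant_sequence_exact₃ (ModuleCat.of R L)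
    (shortExact_of_linearMap hf hfg hg) x rfl (hA.elim _ _)
  rw [hB.elim y 0, Ext.zero_comp]

theorem exists_ext_restrict_eq (hf : Function.Injective f) (hfg : Function.Exact f g)
    (hg : Function.Surjective g) (i : ℕ) (hD : Subsingleton (ModExt R D L (i + 1)))
    (x : ModExt R A L i) :
    ∃ y : ModExt R B L i, (Ext.mk₀ (ModuleCat.ofHom f)).comp y (zero_add i) = x :=
  Ext.contravariant_sequence_exact₁ (shortExact_of_linearMap hf hfg hg) (ModuleCat.of R L) x
    (add_comm 1 i) (hD.elim _ _)

theorem exists_ext_inflate_eq (hf : Function.Injective f) (hfg : Function.Exact f g)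
    (hg : Function.Surjective g) (i : ℕ) (hA : Subsingleton (ModExt R A L i))
    (x : ModExt R B L i) :
    ∃ y : ModExt R D L i, (Ext.mk₀ (ModuleCat.ofHom g)).comp y (zero_add i) = x :=
  Ext.contravariant_sequence_exact₂ (shortExact_of_linearMap hf hfg hg) (ModuleCat.of R L) x
    (hA.elim _ _)

theorem subsingleton_ext_left_of_contravariant (hf : Function.Injective f)
    (hfg : Function.Exact f g)
    (hg : Function.Surjective g) (i : ℕ) (hB : Subsingleton (ModExt R B L i))
    (hD : Subsingleton (ModExt R D L (i + 1))) : Subsingleton (ModExt R A L i) := by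
  refine subsingleton_of_forall_eq 0 fun x ↦ ?_
  obtain ⟨y, rfl⟩ := exists_ext_restrict_eq L hf hfg hg i hD x
  rw [hB.elim y 0, Ext.comp_zero]

theorem subsingleton_ext_right_of_contravariant (hf : Function.Injective f)
    (hfg : Function.Exact f g)
    (hg : Function.Surjective g) (i : ℕ) (hA : Subsingleton (ModExt R A L i))
    (hB : Subsingleton (ModExt R B L (i + 1))) : Subsingleton (ModExt R D L (i + 1)) := by
  refine subsingleton_of_forall_eq 0 fun x ↦ ?_
  obtain ⟨y, rfl⟩ := Ext.contravariant_sequence_exact₃ (shortExact_of_linearMap hf hfg hg)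
    (ModuleCat.of R L) x (hB.elim _ _) (add_comm 1 i)
  rw [hA.elim y 0, Ext.comp_zero]

theorem exists_lift_of_subsingleton_ext (hf : Function.Injective f) (hfg : Function.Exact f g)
    (hg : Function.Surjective g) (hA : Subsingleton (ModExt R L A 1)) (φ : L →ₗ[R] D) :
    ∃ ψ : L →ₗ[R] B, g ∘ₗ ψ = φ := by
  obtain ⟨y, hy⟩ := Ext.covariant_sequence_exact₃ (ModuleCat.of R L)
    (shortExact_of_linearMap hf hfg hg) (Ext.mk₀ (ModuleCat.ofHom φ)) rfl (hA.elim _ _)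
  obtain ⟨ψ, rfl⟩ := (Ext.mk₀_bijective _ _).2 y
  rw [Ext.mk₀_comp_mk₀] at hy
  exact ⟨ψ.hom, congrArg ModuleCat.Hom.hom ((Ext.mk₀_bijective _ _).1 hy)⟩

theorem exists_extension_of_subsingleton_ext (hf : Function.Injective f)
    (hfg : Function.Exact f g)
    (hg : Function.Surjective g) (hD : Subsingleton (ModExt R D L 1)) (φ : A →ₗ[R] L) :
    ∃ ψ : B →ₗ[R] L, ψ ∘ₗ f = φ := by
  obtain ⟨y, hy⟩ := exists_ext_restrict_eq L hf hfg hg 0 hD (Ext.mk₀ (ModuleCat.ofHom φ))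
  obtain ⟨ψ, rfl⟩ := (Ext.mk₀_bijective _ _).2 y
  rw [Ext.mk₀_comp_mk₀] at hy
  exact ⟨ψ.hom, congrArg ModuleCat.Hom.hom ((Ext.mk₀_bijective _ _).1 hy)⟩

theorem subsingleton_ext_one_of_forall_extension (hf : Function.Injective f)
    (hfg : Function.Exact f g)
    (hg : Function.Surjective g) (hB : Subsingleton (ModExt R B L 1))
    (h : ∀ φ : A →ₗ[R] L, ∃ ψ : B →ₗ[R] L, ψ ∘ₗ f = φ) : Subsingleton (ModExt R D L 1) := by
  refine subsingleton_of_forall_eq 0 fun x ↦ ?_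
  have hS := shortExact_of_linearMap hf hfg hg
  obtain ⟨y, rfl⟩ := Ext.contravariant_sequence_exact₃ hS
    (ModuleCat.of R L) x (hB.elim _ _) (add_zero 1)
  obtain ⟨φ, rfl⟩ := (Ext.mk₀_bijective _ _).2 y
  obtain ⟨ψ, hψ⟩ := h φ.hom
  have : φ = ModuleCat.ofHom f ≫ ModuleCat.ofHom ψ := by
    ext1
    exact hψ.symm
  rw [this, ← Ext.mk₀_comp_mk₀]
  exact hS.extClass_comp_assoc _

theorem subsingleton_ext_right_of_sum_retract {ι : Type} [Fintype ι] (p : ι → (B →ₗ[R] D))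
    (s : ι → (D →ₗ[R] B)) (h : ∑ i, s i ∘ₗ p i = LinearMap.id) (j : ℕ)
    (hD : Subsingleton (ModExt R L D j)) : Subsingleton (ModExt R L B j) := by
  refine subsingleton_of_forall_eq 0 fun x ↦ ?_
  have h' : 𝟙 (ModuleCat.of R B) = ∑ i, ModuleCat.ofHom (p i) ≫ ModuleCat.ofHom (s i) := by
    ext1
    rw [ModuleCat.hom_sum]
    exact h.symm
  rw [← Ext.comp_mk₀_id x, h', Ext.mk₀_sum, Ext.comp_sum]
  refine Finset.sum_eq_zero fun i _ ↦ ?_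
  rw [← Ext.mk₀_comp_mk₀, ← Ext.comp_assoc_of_second_deg_zero,
    hD.elim (x.comp (Ext.mk₀ (ModuleCat.ofHom (p i))) (add_zero j)) 0, Ext.zero_comp]

theorem subsingleton_ext_left_of_sum_retract {ι : Type} [Fintype ι] (p : ι → (B →ₗ[R] D))
    (s : ι → (D →ₗ[R] B)) (h : ∑ i, s i ∘ₗ p i = LinearMap.id) (j : ℕ)
    (hD : Subsingleton (ModExt R D L j)) : Subsingleton (ModExt R B L j) := by
  refine subsingleton_of_forall_eq 0 fun x ↦ ?_
  have h' : 𝟙 (ModuleCat.of R B) = ∑ i, ModuleCat.ofHom (p i) ≫ ModuleCat.ofHom (s i) := by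
    ext1
    rw [ModuleCat.hom_sum]
    exact h.symm
  rw [← Ext.mk₀_id_comp x, h', Ext.mk₀_sum, Ext.sum_comp]
  refine Finset.sum_eq_zero fun i _ ↦ ?_
  rw [← Ext.mk₀_comp_mk₀_assoc,
    hD.elim ((Ext.mk₀ (ModuleCat.ofHom (s i))).comp x (zero_add j)) 0, Ext.comp_zero]

theorem subsingleton_ext_of_linearEquiv_right (e : A ≃ₗ[R] B) (j : ℕ)
    (h : Subsingleton (ModExt R L A j)) : Subsingleton (ModExt R L B j) :=
  subsingleton_ext_right_of_sum_retract L (fun _ : Unit ↦ e.symm.toLinearMap)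
    (fun _ ↦ e.toLinearMap) (by ext; simp) j h

theorem subsingleton_ext_of_projective [Module.Projective R L] (B : Type) [AddCommGroup B]
    [Module R B] (j : ℕ) (hj : 1 ≤ j) : Subsingleton (ModExt R L B j) := by
  obtain ⟨j, rfl⟩ := Nat.exists_eq_add_of_le' hj
  have : Projective (ModuleCat.of R L) := ModuleCat.projective_of_categoryTheory_projective _
  exact subsingleton_of_forall_eq 0 Ext.eq_zero_of_projective

end LongExact

section LocalRing

variable {R : Type} [CommRing R] [IsLocalRing R]

theorem exists_minimal_presentation (A : Type) [AddCommGroup A] [Module R A]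
    [Module.Finite R A] : ∃ (n : ℕ) (f : (Fin n → R) →ₗ[R] A), Function.Surjective f ∧
      ∀ v, f v = 0 → ∀ i, v i ∈ maximalIdeal R := by
  let b := Module.finBasis (ResidueField R) (ResidueField R ⊗[R] A)
  have hmk : Function.Surjective (TensorProduct.mk R (ResidueField R) A 1) :=
    TensorProduct.mk_surjective R A (ResidueField R) residue_surjective
  choose a ha using fun i ↦ hmk (b i)
  refine ⟨_, Fintype.linearCombination R a, ?_, fun v hv i ↦ ?_⟩
  · rw [← LinearMap.range_eq_top, Fintype.range_linearCombination]
    exact IsLocalRing.span_eq_top_of_tmul_eq_basis a b ha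
  · have h := congrArg (TensorProduct.mk R (ResidueField R) A 1) hv
    rw [Fintype.linearCombination_apply, map_sum, map_zero] at h
    simp_rw [map_smul, ha] at h
    have h' : ∑ i, residue R (v i) • b i = 0 := by
      rw [← h]
      exact Finset.sum_congr rfl fun i _ ↦ algebraMap_smul _ _ _
    exact (residue_eq_zero_iff _).1 (Fintype.linearIndependent_iff.1 b.linearIndependent _ h' i)

theorem subsingleton_of_subsingleton_tensorProduct (C Q : Type) [AddCommGroup C] [Module R C]
    [Module.Finite R C] [Nontrivial C] [AddCommGroup Q] [Module R Q] [Module.Finite R Q]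
    (h : Subsingleton (C ⊗[R] Q)) : Subsingleton Q := by
  let b := Module.finBasis (ResidueField R) (ResidueField R ⊗[R] C)
  have hne : Nontrivial (ResidueField R ⊗[R] C) := by
    rw [← not_subsingleton_iff_nontrivial, IsLocalRing.subsingleton_tensorProduct]
    exact not_subsingleton C
  obtain ⟨i⟩ := b.index_nonempty
  let φ : C →ₗ[R] ResidueField R :=
    (b.coord i).restrictScalars R ∘ₗ TensorProduct.mk R (ResidueField R) C 1
  have hφ : Function.Surjective φ :=
    Function.Surjective.comp (g := b.coord i) (fun a ↦ ⟨a • b i, by simp⟩)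
      (TensorProduct.mk_surjective R C (ResidueField R) residue_surjective)
  rw [← IsLocalRing.subsingleton_tensorProduct (R := R)]
  exact (LinearMap.rTensor_surjective Q hφ).subsingleton

variable [IsNoetherianRing R]

theorem subsingleton_of_forall_subsingleton_ext (A T : Type) [AddCommGroup A] [Module R A]
    [Module.Finite R A] [Nontrivial A] [AddCommGroup T] [Module R T] [Module.Finite R T]
    (h : ∀ j, Subsingleton (ModExt R A T j)) : Subsingleton T := by
  by_contra hT
  rw [not_subsingleton_iff_nontrivial] at hT
  have hI : Module.annihilator R A ≤ maximalIdeal R := by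
    refine le_maximalIdeal fun h1 ↦ ?_
    exact not_subsingleton A (Module.annihilator_eq_top_iff.1 h1)
  have hlt : Module.annihilator R A • (⊤ : Submodule R T) < ⊤ := by
    refine lt_top_iff_ne_top.2 fun h1 ↦ ?_
    refine (bot_ne_top (α := Submodule R T)).symm
      (Submodule.eq_bot_of_le_smul_of_le_jacobson_bot _ _ Module.Finite.fg_top h1.ge ?_)
    rwa [jacobson_eq_maximalIdeal _ bot_ne_top]
  have hdim : ∀ n : ℕ, (n : WithBot ℕ∞) ≤ ringKrullDim R := by
    intro n
    obtain ⟨rs, rfl, -, hrs⟩ := ModuleCat.exists_isRegular_of_exists_subsingleton_ext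
      (Module.annihilator R A) n (ModuleCat.of R T) hlt (ModuleCat.of R A)
      (Module.support_eq_zeroLocus) (fun i _ ↦ h i)
    have h1 := Module.supportDim_add_length_eq_supportDim_of_isRegular (M := T) rs hrs
    refine le_trans ?_ (Module.supportDim_le_ringKrullDim R T)
    rw [← h1]
    have : Nontrivial (T ⧸ Ideal.ofList rs • (⊤ : Submodule R T)) := by
      rw [Submodule.Quotient.nontrivial_iff]
      exact hrs.top_ne_smul.symm
    have h2 := Module.supportDim_ne_bot_of_nontrivial R
      (T ⧸ Ideal.ofList rs • (⊤ : Submodule R T))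
    obtain ⟨d, hd⟩ := WithBot.ne_bot_iff_exists.1 h2
    rw [← hd]
    norm_cast
    exact le_add_self
  have h3 := ringKrullDim_lt_top (R := R)
  obtain ⟨d, hd⟩ := WithBot.ne_bot_iff_exists.1 (ringKrullDim_ne_bot (R := R))
  rw [← hd] at h3 hdim
  have h4 : d ≠ ⊤ := by
    rintro rfl
    exact h3.ne rfl
  obtain ⟨m, rfl⟩ := ENat.ne_top_iff_exists.1 h4
  have h5 := hdim (m + 1)
  norm_cast at h5
  omega

end LocalRing

section HomSequences

variable {R : Type} [CommRing R]

theorem sum_smulRight_comp_eval (n : ℕ) (Z : Type) [AddCommGroup Z] [Module R Z] :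
    ∑ i : Fin n, (LinearMap.smulRightₗ (M := Z) (LinearMap.proj i : (Fin n → R) →ₗ[R] R)) ∘ₗ
      (LinearMap.applyₗ (Pi.single i (1 : R) : Fin n → R)) = LinearMap.id := by
  refine LinearMap.ext fun h ↦ LinearMap.pi_ext' fun i ↦ LinearMap.ext_ring ?_
  simp only [LinearMap.coe_comp, Function.comp_apply, LinearMap.sum_apply, LinearMap.id_coe, id_eq,
    LinearMap.smulRightₗ_apply, LinearMap.applyₗ_apply_apply, LinearMap.smulRight_apply,
    LinearMap.proj_apply, LinearMap.single_apply]
  rw [Finset.sum_eq_single i (fun b _ hb ↦ by simp [Pi.single_eq_of_ne hb]) (by simp)]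
  simp

theorem subsingleton_ext_hom_free_right (n : ℕ) (L Z : Type) [AddCommGroup L] [Module R L]
    [AddCommGroup Z] [Module R Z] (j : ℕ) (h : Subsingleton (ModExt R L Z j)) :
    Subsingleton (ModExt R L ((Fin n → R) →ₗ[R] Z) j) :=
  subsingleton_ext_right_of_sum_retract L _ _ (sum_smulRight_comp_eval n Z) j h

theorem subsingleton_ext_hom_free_left (n : ℕ) (L Z : Type) [AddCommGroup L] [Module R L]
    [AddCommGroup Z] [Module R Z] (j : ℕ) (h : Subsingleton (ModExt R Z L j)) :
    Subsingleton (ModExt R ((Fin n → R) →ₗ[R] Z) L j) :=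
  subsingleton_ext_left_of_sum_retract L _ _ (sum_smulRight_comp_eval n Z) j h

variable {A B D : Type} [AddCommGroup A] [Module R A]
  [AddCommGroup B] [Module R B] [AddCommGroup D] [Module R D] (L : Type) [AddCommGroup L]
  [Module R L] {f : A →ₗ[R] B} {g : B →ₗ[R] D}

theorem lcomp_surjective_of_subsingleton_ext (hf : Function.Injective f)
    (hfg : Function.Exact f g) (hg : Function.Surjective g)
    (hD : Subsingleton (ModExt R D L 1)) : Function.Surjective (LinearMap.lcomp R L f) :=
  exists_extension_of_subsingleton_ext L hf hfg hg hD

theorem compRight_injective (hf : Function.Injective f) :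
    Function.Injective (f.compRight R : (L →ₗ[R] A) →ₗ[R] (L →ₗ[R] B)) :=
  fun _ _ h ↦ LinearMap.ext fun l ↦ hf (LinearMap.congr_fun h l)

theorem compRight_exact (hf : Function.Injective f) (hfg : Function.Exact f g) :
    Function.Exact (f.compRight R : (L →ₗ[R] A) →ₗ[R] (L →ₗ[R] B)) (g.compRight R) := by
  intro φ
  constructor
  · intro h
    have hr : LinearMap.range φ ≤ LinearMap.range f := by
      rintro _ ⟨l, rfl⟩
      exact (hfg _).1 (LinearMap.congr_fun h l)
    refine ⟨(LinearEquiv.ofInjective f hf).symm.toLinearMap ∘ₗ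
      φ.codRestrict _ fun l ↦ hr ⟨l, rfl⟩, LinearMap.ext fun l ↦ ?_⟩
    exact congrArg Subtype.val ((LinearEquiv.ofInjective f hf).apply_symm_apply
      ⟨φ l, hr ⟨l, rfl⟩⟩)
  · rintro ⟨ψ, rfl⟩
    exact LinearMap.ext fun l ↦ hfg.apply_apply_eq_zero _

theorem compRight_surjective_of_subsingleton_ext (hf : Function.Injective f)
    (hfg : Function.Exact f g) (hg : Function.Surjective g)
    (hA : Subsingleton (ModExt R L A 1)) :
    Function.Surjective (g.compRight R : (L →ₗ[R] B) →ₗ[R] (L →ₗ[R] D)) :=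
  exists_lift_of_subsingleton_ext L hf hfg hg hA

end HomSequences

section ResidueField

variable {R : Type} [CommRing R] [IsLocalRing R]

theorem ext_residueField_comp_smulRight (K : Type) [AddCommGroup K] [Module R K]
    (l : K →ₗ[R] R) (hl : ∀ x, l x ∈ maximalIdeal R) (j : ℕ) (Z : Type) [AddCommGroup Z]
    [Module R Z] (hZ : ∀ i, 1 ≤ i → Subsingleton (ModExt R K Z i))
    (x : ModExt R (ResidueField R) Z j) :
    x.comp (Ext.mk₀ (ModuleCat.ofHom (LinearMap.smulRightₗ (M := Z) l))) (add_zero j) = 0 := by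
  induction j generalizing Z with
  | zero =>
    obtain ⟨φ, rfl⟩ := (Ext.mk₀_bijective _ _).2 x
    rw [Ext.mk₀_comp_mk₀, Ext.mk₀_eq_zero_iff]
    ext a y
    change l y • φ.hom a = 0
    rw [← map_smul, ← algebraMap_smul (ResidueField R) (l y) a]
    erw [(residue_eq_zero_iff _).2 (hl y)]
    simp
  | succ j ih =>
    let J := Injective.under (ModuleCat.of R Z)
    let f : Z →ₗ[R] J := (Injective.ι (ModuleCat.of R Z)).hom
    have hf : Function.Injective f :=
      (ModuleCat.mono_iff_injective (Injective.ι (ModuleCat.of R Z))).1 inferInstance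
    let g := (LinearMap.range f).mkQ
    have hfg : Function.Exact f g := LinearMap.exact_map_mkQ_range f
    have hg : Function.Surjective g := Submodule.mkQ_surjective _
    have hJ : ∀ (L : Type) [AddCommGroup L] [Module R L] (i : ℕ), 1 ≤ i →
        Subsingleton (ModExt R L J i) := by
      intro L _ _ i hi
      obtain ⟨i, rfl⟩ := Nat.exists_eq_add_of_le' hi
      exact subsingleton_of_forall_eq 0 fun y ↦ Ext.eq_zero_of_injective (I := J) y
    have hS := shortExact_of_linearMap hf hfg hg
    have hT := shortExact_of_linearMap (compRight_injective K hf) (compRight_exact K hf hfg)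
      (compRight_surjective_of_subsingleton_ext K hf hfg hg (hZ 1 le_rfl))
    obtain ⟨y, rfl⟩ := Ext.covariant_sequence_exact₁ (ModuleCat.of R (ResidueField R))
      hS x ((hJ _ _ (by omega)).elim _ _) rfl
    let τ : ModuleCat.shortComplexOfCompEqZero f g hfg.linearMap_comp_eq_zero ⟶
      ModuleCat.shortComplexOfCompEqZero (f.compRight R) (g.compRight R)
        (compRight_exact K hf hfg).linearMap_comp_eq_zero :=
      { τ₁ := ModuleCat.ofHom (LinearMap.smulRightₗ l)
        τ₂ := ModuleCat.ofHom (LinearMap.smulRightₗ l)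
        τ₃ := ModuleCat.ofHom (LinearMap.smulRightₗ l)
        comm₁₂ := by
          ext z κ
          exact map_smul f (l κ) z
        comm₂₃ := by
          ext z κ
          exact map_smul g (l κ) z }
    have hnat := ShortComplex.ShortExact.extClass_naturality hS hT τ
    have h0 := ih _ (fun i hi ↦ subsingleton_ext_right_of_covariant K hf hfg hg i
      (hJ K i hi) (hZ (i + 1) (by omega))) y
    change (y.comp hS.extClass _).comp (Ext.mk₀ τ.τ₁) _ = 0
    rw [Ext.comp_assoc_of_third_deg_zero, hnat, ← Ext.comp_assoc_of_second_deg_zero]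
    erw [h0]
    rw [Ext.zero_comp]

end ResidueField

section Freeness

variable {R : Type} [CommRing R]

theorem lcomp_eq_sum_smulRight_comp_eval (n : ℕ) (K Z : Type) [AddCommGroup K] [Module R K]
    [AddCommGroup Z] [Module R Z] (e : K →ₗ[R] (Fin n → R)) :
    LinearMap.lcomp R Z e = ∑ i : Fin n,
      (LinearMap.smulRightₗ (M := Z) ((LinearMap.proj i : (Fin n → R) →ₗ[R] R) ∘ₗ e)) ∘ₗ
        (LinearMap.applyₗ (Pi.single i (1 : R) : Fin n → R)) := by
  refine LinearMap.ext fun φ ↦ LinearMap.ext fun x ↦ ?_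
  have h := LinearMap.congr_fun (LinearMap.congr_fun (sum_smulRight_comp_eval n Z) φ) (e x)
  simpa [LinearMap.sum_apply] using h.symm

variable [IsLocalRing R]

theorem ext_residueField_comp_lcomp (n : ℕ) (K Z : Type) [AddCommGroup K] [Module R K]
    [AddCommGroup Z] [Module R Z] (e : K →ₗ[R] (Fin n → R))
    (he : ∀ x i, e x i ∈ maximalIdeal R) (hZ : ∀ i, 1 ≤ i → Subsingleton (ModExt R K Z i))
    (j : ℕ) (y : ModExt R (ResidueField R) ((Fin n → R) →ₗ[R] Z) j) :
    y.comp (Ext.mk₀ (ModuleCat.ofHom (LinearMap.lcomp R Z e))) (add_zero j) = 0 := by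
  have h : ModuleCat.ofHom (LinearMap.lcomp R Z e) = ∑ i : Fin n,
      ModuleCat.ofHom (LinearMap.applyₗ (Pi.single i (1 : R) : Fin n → R)) ≫ ModuleCat.ofHom
        (LinearMap.smulRightₗ (M := Z) ((LinearMap.proj i : (Fin n → R) →ₗ[R] R) ∘ₗ e)) := by
    ext1
    rw [ModuleCat.hom_sum]
    exact lcomp_eq_sum_smulRight_comp_eval n K Z e
  rw [h, Ext.mk₀_sum, Ext.comp_sum]
  refine Finset.sum_eq_zero fun i _ ↦ ?_
  rw [← Ext.mk₀_comp_mk₀, ← Ext.comp_assoc_of_second_deg_zero]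
  exact ext_residueField_comp_smulRight K _ (fun x ↦ he x i) j Z hZ _

variable [IsNoetherianRing R]

theorem free_of_subsingleton_ext_residueField_hom (C : Type) [AddCommGroup C] [Module R C]
    [Module.Finite R C] [Nontrivial C] (n : ℕ) (A : Type) [AddCommGroup A] [Module R A]
    [Module.Finite R A] (hAC : ∀ i, 1 ≤ i → Subsingleton (ModExt R A C i))
    (hAR : ∀ i, 1 ≤ i → Subsingleton (ModExt R A R i))
    (h : ∀ j, n ≤ j → Subsingleton (ModExt R (ResidueField R) (A →ₗ[R] C) j)) :
    Module.Free R A := by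
  induction n generalizing A with
  | zero =>
    have h0 := subsingleton_of_forall_subsingleton_ext (ResidueField R) (A →ₗ[R] C)
      fun j ↦ h j (Nat.zero_le j)
    rcases subsingleton_or_nontrivial A with hA | hA
    · exact Module.Free.of_subsingleton R A
    · refine absurd (subsingleton_of_forall_subsingleton_ext (R := R) A C fun j ↦ ?_)
        (not_subsingleton C)
      rcases j with - | j
      · exact (Ext.addEquiv₀.trans ModuleCat.homAddEquiv).subsingleton
      · exact hAC _ (by omega)
  | succ n ih =>
    obtain ⟨m, f, hf, hmin⟩ := exists_minimal_presentation (R := R) A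
    let K := LinearMap.ker f
    let e : K →ₗ[R] (Fin m → R) := K.subtype
    have he : Function.Injective e := K.injective_subtype
    have hef : Function.Exact e f := LinearMap.exact_subtype_ker_map f
    have hK : ∀ (Z : Type) [AddCommGroup Z] [Module R Z],
        (∀ i, 1 ≤ i → Subsingleton (ModExt R A Z i)) →
        ∀ i, 1 ≤ i → Subsingleton (ModExt R K Z i) := fun Z _ _ hZ i hi ↦
      subsingleton_ext_left_of_contravariant Z he hef hf i
        (subsingleton_ext_of_projective _ Z i hi) (hZ (i + 1) (by omega))
    have hfree : Module.Free R K := by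
      refine ih K (hK C hAC) (hK R hAR) fun j hj ↦ subsingleton_of_forall_eq 0 fun x ↦ ?_
      obtain ⟨y, rfl⟩ := Ext.covariant_sequence_exact₃ (ModuleCat.of R (ResidueField R))
        (shortExact_of_linearMap (LinearMap.lcomp_injective_of_surjective f hf)
          (LinearMap.exact_lcomp_of_exact_of_surjective C hef hf)
          (lcomp_surjective_of_subsingleton_ext C he hef hf (hAC 1 le_rfl)))
        x rfl ((h (j + 1) (by omega)).elim _ _)
      exact ext_residueField_comp_lcomp m K C e (fun x ↦ hmin _ x.2) (hK C hAC) j y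
    have hAK : Subsingleton (ModExt R A K 1) := by
      let b := Module.finBasis R K
      refine subsingleton_ext_right_of_sum_retract A (fun i ↦ b.coord i)
        (fun i ↦ LinearMap.toSpanSingleton R K (b i)) ?_ 1 (hAR 1 le_rfl)
      refine LinearMap.ext fun x ↦ ?_
      simp [b.sum_repr]
    obtain ⟨ψ, hψ⟩ := exists_lift_of_subsingleton_ext A he hef hf hAK LinearMap.id
    have : Module.Projective R A := Module.Projective.of_split ψ f hψ
    exact Module.free_of_flat_of_isLocalRing

end Freeness

section Evaluation

variable {R : Type} [CommRing R]

theorem lcomp_comp_smulRight_proj {m n : ℕ} (d : (Fin n → R) →ₗ[R] (Fin m → R)) (i : Fin m)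
    (Z : Type) [AddCommGroup Z] [Module R Z] :
    LinearMap.lcomp R Z d ∘ₗ LinearMap.smulRightₗ (LinearMap.proj i) =
      ∑ j : Fin n, d (Pi.single j 1) i • LinearMap.smulRightₗ (LinearMap.proj j) := by
  refine LinearMap.ext fun z ↦ LinearMap.pi_ext' fun j ↦ LinearMap.ext_ring ?_
  simp only [LinearMap.coe_comp, Function.comp_apply, LinearMap.sum_apply,
    LinearMap.lcomp_apply, LinearMap.smul_apply,
    LinearMap.smulRightₗ_apply, LinearMap.smulRight_apply,
    LinearMap.proj_apply, LinearMap.single_apply]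
  rw [Finset.sum_eq_single j (fun b _ hb ↦ by simp [Pi.single_eq_of_ne hb]) (by simp)]
  simp

theorem exists_eq_sum_tmul {m : ℕ} {C W : Type} [AddCommGroup C] [Module R C] [AddCommGroup W]
    [Module R W] (f : (Fin m → R) →ₗ[R] C) (hf : Function.Surjective f) (t : C ⊗[R] W) :
    ∃ w : Fin m → W, t = ∑ i, f (Pi.single i 1) ⊗ₜ[R] w i := by
  induction t with
  | zero => exact ⟨0, by simp⟩
  | tmul c w =>
    obtain ⟨v, rfl⟩ := hf c
    refine ⟨fun i ↦ v i • w, ?_⟩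
    conv_lhs => rw [pi_eq_sum_univ' v]
    simp [TensorProduct.sum_tmul, TensorProduct.smul_tmul']
  | add x y hx hy =>
    obtain ⟨a, rfl⟩ := hx
    obtain ⟨b, rfl⟩ := hy
    exact ⟨a + b, by simp [TensorProduct.tmul_add, Finset.sum_add_distrib]⟩

variable [IsNoetherianRing R]

theorem subsingleton_ext_hom_left (C N : Type) [AddCommGroup C] [Module R C] [AddCommGroup N]
    [Module R N] (n s : ℕ)
    (hN : ∀ (L : Type) [AddCommGroup L] [Module R L], ∀ j, n < j → Subsingleton (ModExt R L N j))
    (hCN : ∀ j, s < j → Subsingleton (ModExt R C N j)) (K : Type) [AddCommGroup K] [Module R K]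
    [Module.Finite R K] (hKC : ∀ j, 1 ≤ j → Subsingleton (ModExt R K C j)) (j : ℕ) (hj : s < j) :
    Subsingleton (ModExt R (K →ₗ[R] C) N j) := by
  obtain ⟨t, ht⟩ : ∃ t, n < j + t := ⟨n + 1, by omega⟩
  induction t generalizing K j with
  | zero => exact hN _ j ht
  | succ t ih =>
    obtain ⟨m, f, hf⟩ := Module.Finite.exists_fin' R K
    have he := (LinearMap.ker f).injective_subtype
    have hef : Function.Exact (LinearMap.ker f).subtype f := LinearMap.exact_subtype_ker_map f
    refine subsingleton_ext_left_of_contravariant N (LinearMap.lcomp_injective_of_surjective f hf)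
      (LinearMap.exact_lcomp_of_exact_of_surjective C hef hf)
      (lcomp_surjective_of_subsingleton_ext C he hef hf (hKC 1 le_rfl)) j
      (subsingleton_ext_hom_free_left m N C j (hCN j hj))
      (ih (LinearMap.ker f) (fun i hi ↦ ?_) (j + 1) (by omega) (by omega))
    exact subsingleton_ext_left_of_contravariant C he hef hf i
        (subsingleton_ext_of_projective _ C i hi) (hKC (i + 1) (by omega))

variable [IsLocalRing R]

theorem subsingleton_ext_left_semidualizing (C N : Type) [AddCommGroup C] [Module R C]
    [Module.Finite R C] [Nontrivial C] [AddCommGroup N] [Module R N] [Module.Finite R N]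
    (hC : Function.Bijective (LinearMap.lsmul R C))
    (hCC : ∀ j, 1 ≤ j → Subsingleton (ModExt R C C j)) (n : ℕ)
    (hN : ∀ (L : Type) [AddCommGroup L] [Module R L], ∀ j, n < j → Subsingleton (ModExt R L N j))
    (s : ℕ) (hs : 1 ≤ s) : Subsingleton (ModExt R C N s) := by
  obtain ⟨t, ht⟩ : ∃ t, n < s + t := ⟨n + 1, by omega⟩
  induction t generalizing s with
  | zero => exact hN _ s ht
  | succ t ih =>
    obtain ⟨m, f₀, hf₀, hmin⟩ := exists_minimal_presentation (R := R) C
    let K₀ := LinearMap.ker f₀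
    have he₀ := K₀.injective_subtype
    have hef₀ : Function.Exact K₀.subtype f₀ := LinearMap.exact_subtype_ker_map f₀
    obtain ⟨m₁, f₁, hf₁⟩ := Module.Finite.exists_fin' R K₀
    let K₁ := LinearMap.ker f₁
    have he₁ := K₁.injective_subtype
    have hef₁ : Function.Exact K₁.subtype f₁ := LinearMap.exact_subtype_ker_map f₁
    have hK₀ : ∀ i, 1 ≤ i → Subsingleton (ModExt R K₀ C i) := fun i hi ↦
      subsingleton_ext_left_of_contravariant C he₀ hef₀ hf₀ i
        (subsingleton_ext_of_projective _ C i hi) (hCC (i + 1) (by omega))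
    have hK₁ : ∀ i, 1 ≤ i → Subsingleton (ModExt R K₁ C i) := fun i hi ↦
      subsingleton_ext_left_of_contravariant C he₁ hef₁ hf₁ i
        (subsingleton_ext_of_projective _ C i hi) (hK₀ (i + 1) (by omega))
    have hm : Nonempty (Fin m) := by
      by_contra hm
      rw [not_nonempty_iff] at hm
      exact not_subsingleton C hf₀.subsingleton
    let i₀ : Fin m := Classical.arbitrary _
    let d := K₀.subtype ∘ₗ f₁
    have hR : Module.Projective R (C →ₗ[R] C) :=
      Module.Projective.of_equiv (LinearEquiv.ofBijective (LinearMap.lsmul R C) hC)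
    have key : ∀ q : ModExt R C N s,
        q ∈ maximalIdeal R • (⊤ : Submodule R (ModExt R C N s)) := by
      intro q
      obtain ⟨y, hy⟩ := exists_ext_inflate_eq N (LinearMap.lcomp_injective_of_surjective f₀ hf₀)
        (LinearMap.exact_lcomp_of_exact_of_surjective C hef₀ hf₀)
        (lcomp_surjective_of_subsingleton_ext C he₀ hef₀ hf₀ (hCC 1 le_rfl)) s
        (subsingleton_ext_of_projective _ N s hs)
        ((Ext.mk₀ (ModuleCat.ofHom
          (LinearMap.applyₗ (Pi.single i₀ (1 : R) : Fin m → R)))).comp q (zero_add s))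
      obtain ⟨z, rfl⟩ := exists_ext_restrict_eq N (LinearMap.lcomp_injective_of_surjective f₁ hf₁)
        (LinearMap.exact_lcomp_of_exact_of_surjective C hef₁ hf₁)
        (lcomp_surjective_of_subsingleton_ext C he₁ hef₁ hf₁ (hK₀ 1 le_rfl)) s
        (subsingleton_ext_hom_left C N n s hN (fun j hj ↦ ih j (by omega) (by omega)) K₁ hK₁
          (s + 1) (by omega)) y
      have h1 : ModuleCat.ofHom (LinearMap.smulRightₗ (M := C)
          (LinearMap.proj i₀ : (Fin m → R) →ₗ[R] R)) ≫ ModuleCat.ofHom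
          (LinearMap.applyₗ (Pi.single i₀ (1 : R) : Fin m → R)) = 𝟙 (ModuleCat.of R C) := by
        ext c
        simp
      have h2 : (ModuleCat.ofHom (LinearMap.smulRightₗ (M := C)
          (LinearMap.proj i₀ : (Fin m → R) →ₗ[R] R)) ≫ ModuleCat.ofHom
          (LinearMap.lcomp R C K₀.subtype)) ≫ ModuleCat.ofHom (LinearMap.lcomp R C f₁) =
          ∑ j : Fin m₁, d (Pi.single j 1) i₀ • ModuleCat.ofHom (LinearMap.smulRightₗ (M := C)
            (LinearMap.proj j : (Fin m₁ → R) →ₗ[R] R)) := by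
        ext1
        rw [ModuleCat.hom_sum]
        exact lcomp_comp_smulRight_proj d i₀ C
      have h3 := congrArg (fun x ↦ (Ext.mk₀ (ModuleCat.ofHom (LinearMap.smulRightₗ (M := C)
          (LinearMap.proj i₀ : (Fin m → R) →ₗ[R] R)))).comp x (zero_add s)) hy
      simp only [Ext.mk₀_comp_mk₀_assoc] at h3
      rw [h1, ← Category.assoc, h2, Ext.mk₀_id_comp, Ext.mk₀_sum, Ext.sum_comp] at h3
      rw [← h3]
      refine Submodule.sum_mem _ fun j _ ↦ ?_
      rw [Ext.mk₀_smul, Ext.smul_comp]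
      exact Submodule.smul_mem_smul (hmin _ (f₁ (Pi.single j 1)).2 i₀) Submodule.mem_top
    have hfin : Module.Finite R (ModExt R C N s) := inferInstance
    have h4 : (⊤ : Submodule R (ModExt R C N s)) = ⊥ := by
      refine Submodule.eq_bot_of_le_smul_of_le_jacobson_bot (maximalIdeal R) _ hfin.fg_top
        (fun q _ ↦ key q) ?_
      rw [jacobson_eq_maximalIdeal _ bot_ne_top]
    exact (Submodule.subsingleton_iff R).1 (subsingleton_of_top_le_bot h4.le)

theorem lift_applyₗ_injective (C N : Type) [AddCommGroup C] [Module R C]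
    [Module.Finite R C] [Nontrivial C] [AddCommGroup N] [Module R N] [Module.Finite R N]
    (hC : Function.Bijective (LinearMap.lsmul R C))
    (hCC : ∀ j, 1 ≤ j → Subsingleton (ModExt R C C j)) (n : ℕ)
    (hN : ∀ (L : Type) [AddCommGroup L] [Module R L], ∀ j, n < j → Subsingleton (ModExt R L N j)) :
    Function.Injective
      (TensorProduct.lift (LinearMap.applyₗ : C →ₗ[R] (C →ₗ[R] N) →ₗ[R] N)) := by
  refine (injective_iff_map_eq_zero _).2 fun t ht ↦ ?_
  obtain ⟨m, f₀, hf₀⟩ := Module.Finite.exists_fin' R C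
  let K₀ := LinearMap.ker f₀
  have he₀ := K₀.injective_subtype
  have hef₀ : Function.Exact K₀.subtype f₀ := LinearMap.exact_subtype_ker_map f₀
  obtain ⟨m₁, f₁, hf₁⟩ := Module.Finite.exists_fin' R K₀
  let K₁ := LinearMap.ker f₁
  have he₁ := K₁.injective_subtype
  have hef₁ : Function.Exact K₁.subtype f₁ := LinearMap.exact_subtype_ker_map f₁
  have hK₀ : ∀ i, 1 ≤ i → Subsingleton (ModExt R K₀ C i) := fun i hi ↦
    subsingleton_ext_left_of_contravariant C he₀ hef₀ hf₀ i
      (subsingleton_ext_of_projective _ C i hi) (hCC (i + 1) (by omega))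
  have hK₁ : ∀ i, 1 ≤ i → Subsingleton (ModExt R K₁ C i) := fun i hi ↦
    subsingleton_ext_left_of_contravariant C he₁ hef₁ hf₁ i
      (subsingleton_ext_of_projective _ C i hi) (hK₀ (i + 1) (by omega))
  obtain ⟨w, rfl⟩ := exists_eq_sum_tmul f₀ hf₀ t
  let u : ((Fin m → R) →ₗ[R] C) →ₗ[R] N :=
    ∑ i, w i ∘ₗ LinearMap.applyₗ (Pi.single i (1 : R) : Fin m → R)
  have hu : u ∘ₗ LinearMap.lcomp R C f₀ = 0 := by
    refine LinearMap.ext fun h ↦ ?_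
    obtain ⟨r, rfl⟩ := hC.2 h
    simp only [map_sum, TensorProduct.lift.tmul, LinearMap.applyₗ_apply_apply] at ht
    simp only [u, LinearMap.coe_comp, Function.comp_apply, LinearMap.sum_apply,
      LinearMap.applyₗ_apply_apply, LinearMap.lcomp_apply, LinearMap.lsmul_apply, map_smul,
      LinearMap.zero_apply]
    rw [← Finset.smul_sum, ht, smul_zero]
  obtain ⟨u', hu'⟩ := (LinearMap.exact_lcomp_of_exact_of_surjective N
    (LinearMap.exact_lcomp_of_exact_of_surjective C hef₀ hf₀)
    (lcomp_surjective_of_subsingleton_ext C he₀ hef₀ hf₀ (hCC 1 le_rfl)) u).1 hu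
  obtain ⟨u'', rfl⟩ := exists_extension_of_subsingleton_ext N
    (LinearMap.lcomp_injective_of_surjective f₁ hf₁)
    (LinearMap.exact_lcomp_of_exact_of_surjective C hef₁ hf₁)
    (lcomp_surjective_of_subsingleton_ext C he₁ hef₁ hf₁ (hK₀ 1 le_rfl))
    (subsingleton_ext_hom_left C N n 0 hN
      (fun j hj ↦ subsingleton_ext_left_semidualizing C N hC hCC n hN j hj) K₁ hK₁ 1 one_pos) u'
  let d := K₀.subtype ∘ₗ f₁
  have hw : ∀ i, w i = ∑ j, d (Pi.single j 1) i •
      (u'' ∘ₗ LinearMap.smulRightₗ (LinearMap.proj j)) := by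
    intro i
    have h1 : w i = u ∘ₗ LinearMap.smulRightₗ (LinearMap.proj i) := by
      refine LinearMap.ext fun c ↦ ?_
      simp only [u, LinearMap.coe_comp, Function.comp_apply, LinearMap.sum_apply,
        LinearMap.applyₗ_apply_apply, LinearMap.smulRightₗ_apply, LinearMap.smulRight_apply,
        LinearMap.proj_apply]
      rw [Finset.sum_eq_single i (fun b _ hb ↦ by simp [Pi.single_eq_of_ne' hb]) (by simp)]
      simp
    have h2 := congrArg (u'' ∘ₗ ·) (lcomp_comp_smulRight_proj d i C)
    rw [h1, ← hu']
    refine Eq.trans h2 (LinearMap.ext fun c ↦ ?_)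
    simp [LinearMap.sum_apply]
  have hd : ∀ j, ∑ i, d (Pi.single j 1) i • f₀ (Pi.single i 1) = 0 := by
    intro j
    have h1 : f₀ (d (Pi.single j 1)) = 0 := (f₁ (Pi.single j 1)).2
    conv_lhs at h1 => rw [pi_eq_sum_univ' (d (Pi.single j 1))]
    simpa using h1
  simp_rw [hw, TensorProduct.tmul_sum]
  rw [Finset.sum_comm]
  refine Finset.sum_eq_zero fun j _ ↦ ?_
  simp_rw [← TensorProduct.smul_tmul, ← TensorProduct.sum_tmul]
  rw [hd, TensorProduct.zero_tmul]

theorem mk_flip_surjective_of_lift_applyₗ_injective (C X : Type) [AddCommGroup C] [Module R C]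
    [Module.Finite R C] [Nontrivial C] [AddCommGroup X] [Module R X] [Module.Finite R X]
    (h : Function.Injective (TensorProduct.lift
      (LinearMap.applyₗ : C →ₗ[R] (C →ₗ[R] C ⊗[R] X) →ₗ[R] C ⊗[R] X))) :
    Function.Surjective (TensorProduct.mk R C X).flip := by
  let η := (TensorProduct.mk R C X).flip
  let P := LinearMap.range η
  have h1 : ∀ t : C ⊗[R] X, TensorProduct.lift
      (LinearMap.applyₗ : C →ₗ[R] (C →ₗ[R] C ⊗[R] X) →ₗ[R] C ⊗[R] X) (η.lTensor C t) = t := by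
    intro t
    induction t with
    | zero => simp
    | tmul c x => simp [η]
    | add x y hx hy => rw [map_add, map_add, hx, hy]
  have h2 : Subsingleton (C ⊗[R] ((C →ₗ[R] C ⊗[R] X) ⧸ P)) := by
    refine subsingleton_of_forall_eq 0 fun t ↦ ?_
    obtain ⟨s, rfl⟩ := LinearMap.lTensor_surjective C P.mkQ_surjective t
    have h3 : s = η.lTensor C (TensorProduct.lift LinearMap.applyₗ s) := h (h1 _).symm
    rw [h3, ← LinearMap.comp_apply, ← LinearMap.lTensor_comp, LinearMap.range_mkQ_comp]
    simp
  have h4 := subsingleton_of_subsingleton_tensorProduct C _ h2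
  rw [Submodule.Quotient.subsingleton_iff] at h4
  exact LinearMap.range_eq_top.1 h4

end Evaluation

section DualTensor

variable {R : Type} [CommRing R]

/-- The natural map `C ⊗ Hom(K, R) → Hom(K, C)`, sending `c ⊗ φ` to `k ↦ φ k • c`. -/
def tensorDualHom (C K : Type) [AddCommGroup C] [Module R C] [AddCommGroup K] [Module R K] :
    C ⊗[R] (K →ₗ[R] R) →ₗ[R] (K →ₗ[R] C) :=
  TensorProduct.lift LinearMap.smulRightₗ.flip

@[simp]
theorem tensorDualHom_tmul (C K : Type) [AddCommGroup C] [Module R C] [AddCommGroup K]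
    [Module R K] (c : C) (φ : K →ₗ[R] R) (k : K) :
    tensorDualHom C K (c ⊗ₜ φ) k = φ k • c :=
  rfl

theorem tensorDualHom_lTensor_lcomp (C : Type) {K L : Type} [AddCommGroup C] [Module R C]
    [AddCommGroup K] [Module R K] [AddCommGroup L] [Module R L] (e : K →ₗ[R] L)
    (t : C ⊗[R] (L →ₗ[R] R)) :
    tensorDualHom C K ((LinearMap.lcomp R R e).lTensor C t) = tensorDualHom C L t ∘ₗ e := by
  induction t with
  | zero => simp
  | tmul c φ => rfl
  | add x y hx hy => rw [map_add, map_add, map_add, hx, hy, LinearMap.add_comp]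

theorem tensorDualHom_free_bijective (C : Type) [AddCommGroup C] [Module R C] (m : ℕ) :
    Function.Bijective (tensorDualHom (R := R) C (Fin m → R)) := by
  let ρ : ((Fin m → R) →ₗ[R] C) →ₗ[R] C ⊗[R] ((Fin m → R) →ₗ[R] R) :=
    ∑ i, (TensorProduct.mk R C _).flip (LinearMap.proj i) ∘ₗ
      LinearMap.applyₗ (Pi.single i (1 : R) : Fin m → R)
  refine ⟨Function.LeftInverse.injective (g := ρ) fun t ↦ ?_,
    Function.RightInverse.surjective (g := ρ) fun h ↦ ?_⟩
  · induction t with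
    | zero => simp
    | tmul c φ =>
      have h := LinearMap.congr_fun (sum_smulRight_comp_eval m R) φ
      conv_rhs => rw [← LinearMap.id_apply (R := R) φ, ← h]
      simp only [ρ, LinearMap.sum_apply, LinearMap.coe_comp, Function.comp_apply,
        LinearMap.applyₗ_apply_apply, tensorDualHom_tmul, LinearMap.flip_apply,
        TensorProduct.mk_apply, TensorProduct.tmul_sum, TensorProduct.smul_tmul]
      refine Finset.sum_congr rfl fun i _ ↦ congrArg _ (LinearMap.ext fun v ↦ ?_)
      simp [mul_comm]
    | add x y hx hy => rw [map_add, map_add, hx, hy]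
  · refine Eq.trans ?_ (LinearMap.congr_fun (sum_smulRight_comp_eval m C) h)
    simp only [ρ, LinearMap.sum_apply, map_sum]
    rfl

/-- The conditions on a module `K` that are inherited by its syzygies and force
`C ⊗ Hom(K, R) ≅ Hom(K, C)` and `Ext^i(K, C) = 0` for `i ≥ 1`. -/
structure DualVanishing (C K : Type) [AddCommGroup C] [Module R C] [AddCommGroup K]
    [Module R K] : Prop where
  ext_tensor : ∀ j, 1 ≤ j → Subsingleton (ModExt R C (C ⊗[R] (K →ₗ[R] R)) j)
  mk_surjective : Function.Surjective (TensorProduct.mk R C (K →ₗ[R] R)).flip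
  ext_ring : ∀ j, 1 ≤ j → Subsingleton (ModExt R K R j)

variable [IsNoetherianRing R] {C K : Type} [AddCommGroup C] [Module R C]
    [Module.Finite R C] [AddCommGroup K] [Module R K] [Module.Finite R K] {m : ℕ}
    {f : (Fin m → R) →ₗ[R] K}

theorem DualVanishing.lTensor_lcomp_injective (hC : Function.Bijective (LinearMap.lsmul R C))
    (hK : DualVanishing (R := R) C K) (hf : Function.Surjective f) :
    Function.Injective ((LinearMap.lcomp R R f).lTensor C) := by
  let T := LinearMap.ker ((LinearMap.lcomp R R f).lTensor C)
  have hT : Subsingleton (C →ₗ[R] T) := by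
    refine subsingleton_of_forall_eq 0 fun ψ ↦ ?_
    obtain ⟨x, hx⟩ := hK.mk_surjective (T.subtype ∘ₗ ψ)
    have hx0 : x = 0 := by
      refine LinearMap.ext fun k ↦ ?_
      obtain ⟨v, rfl⟩ := hf k
      refine hC.1 (LinearMap.ext fun c ↦ ?_)
      have h1 : (LinearMap.lcomp R R f).lTensor C (c ⊗ₜ x) = 0 := by
        have h2 := LinearMap.congr_fun hx c
        exact (congrArg _ h2).trans (ψ c).2
      have h3 := congrArg (fun t ↦ tensorDualHom C _ t v) h1
      simpa using h3
    refine LinearMap.ext fun c ↦ Subtype.ext ?_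
    refine (LinearMap.congr_fun hx c).symm.trans ?_
    simp [hx0]
  obtain ⟨r, hr, hreg⟩ := IsSMulRegular.subsingleton_linearMap_iff.1 hT
  have hr0 : r = 0 := hC.1 (LinearMap.ext fun c ↦ by
    simpa using Module.mem_annihilator.1 hr c)
  rw [hr0] at hreg
  have := hreg.subsingleton
  exact LinearMap.ker_eq_bot.1 (Submodule.subsingleton_iff_eq_bot.1 this)

theorem DualVanishing.ker (hC : Function.Bijective (LinearMap.lsmul R C))
    (hCC : ∀ j, 1 ≤ j → Subsingleton (ModExt R C C j))
    (hK : DualVanishing (R := R) C K) (hf : Function.Surjective f) :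
    DualVanishing (R := R) C (LinearMap.ker f) := by
  have he := (LinearMap.ker f).injective_subtype
  have hef : Function.Exact (LinearMap.ker f).subtype f := LinearMap.exact_subtype_ker_map f
  have hs := lcomp_surjective_of_subsingleton_ext R he hef hf (hK.ext_ring 1 le_rfl)
  have hinj := hK.lTensor_lcomp_injective hC hf
  have hex := lTensor_exact C (LinearMap.exact_lcomp_of_exact_of_surjective R hef hf) hs
  have hsurj := LinearMap.lTensor_surjective C hs
  refine ⟨fun j hj ↦ ?_, fun φ ↦ ?_, fun j hj ↦ ?_⟩
  · exact subsingleton_ext_right_of_covariant C hinj hex hsurj j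
      (subsingleton_ext_of_linearEquiv_right C
        (LinearEquiv.ofBijective _ (tensorDualHom_free_bijective C m)).symm j
        (subsingleton_ext_hom_free_right m C C j (hCC j hj)))
      (hK.ext_tensor (j + 1) (by omega))
  · obtain ⟨ψ, rfl⟩ := exists_lift_of_subsingleton_ext C hinj hex hsurj
      (hK.ext_tensor 1 le_rfl) φ
    choose r hr using fun i ↦ hC.2
      (LinearMap.applyₗ (Pi.single i (1 : R) : Fin m → R) ∘ₗ tensorDualHom C _ ∘ₗ ψ)
    let x : (Fin m → R) →ₗ[R] R := ∑ i, r i • LinearMap.proj i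
    have hψ : ∀ c, ψ c = c ⊗ₜ x := by
      intro c
      refine (tensorDualHom_free_bijective C m).1 (LinearMap.pi_ext' fun i ↦
        LinearMap.ext_ring ?_)
      refine (LinearMap.congr_fun (hr i) c).symm.trans ?_
      simp only [LinearMap.lsmul_apply, LinearMap.coe_comp, Function.comp_apply,
        LinearMap.single_apply, tensorDualHom_tmul, x, LinearMap.sum_apply,
        LinearMap.smul_apply, LinearMap.proj_apply]
      rw [Finset.sum_eq_single i (fun b _ hb ↦ by simp [Pi.single_eq_of_ne hb]) (by simp)]
      simp
    refine ⟨x ∘ₗ (LinearMap.ker f).subtype, LinearMap.ext fun c ↦ ?_⟩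
    simp [hψ, LinearMap.lcomp_apply']
  · exact subsingleton_ext_left_of_contravariant R he hef hf j
      (subsingleton_ext_of_projective _ R j hj) (hK.ext_ring (j + 1) (by omega))

theorem DualVanishing.tensorDualHom_injective (hC : Function.Bijective (LinearMap.lsmul R C))
    (hK : DualVanishing (R := R) C K) : Function.Injective (tensorDualHom (R := R) C K) := by
  obtain ⟨m, f, hf⟩ := Module.Finite.exists_fin' R K
  refine Function.Injective.of_comp (f := LinearMap.lcomp R C f) ?_
  have h : LinearMap.lcomp R C f ∘ tensorDualHom C K =
      tensorDualHom C _ ∘ (LinearMap.lcomp R R f).lTensor C :=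
    funext fun t ↦ (tensorDualHom_lTensor_lcomp C f t).symm
  rw [h]
  exact (tensorDualHom_free_bijective C m).1.comp (hK.lTensor_lcomp_injective hC hf)

theorem DualVanishing.tensorDualHom_bijective (hC : Function.Bijective (LinearMap.lsmul R C))
    (hCC : ∀ j, 1 ≤ j → Subsingleton (ModExt R C C j))
    (hK : DualVanishing (R := R) C K) : Function.Bijective (tensorDualHom (R := R) C K) := by
  refine ⟨hK.tensorDualHom_injective hC, fun h ↦ ?_⟩
  obtain ⟨m, f, hf⟩ := Module.Finite.exists_fin' R K
  have he := (LinearMap.ker f).injective_subtype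
  have hef : Function.Exact (LinearMap.ker f).subtype f := LinearMap.exact_subtype_ker_map f
  have hs := lcomp_surjective_of_subsingleton_ext R he hef hf (hK.ext_ring 1 le_rfl)
  have hex := lTensor_exact C (LinearMap.exact_lcomp_of_exact_of_surjective R hef hf) hs
  obtain ⟨z, hz⟩ := (tensorDualHom_free_bijective C m).2 (h ∘ₗ f)
  obtain ⟨y, rfl⟩ := (hex z).1 <| (hK.ker hC hCC hf).tensorDualHom_injective hC <| by
    rw [tensorDualHom_lTensor_lcomp, hz, LinearMap.comp_assoc, hef.linearMap_comp_eq_zero,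
      LinearMap.comp_zero, map_zero]
  refine ⟨y, LinearMap.lcomp_injective_of_surjective (S := R) (N := C) f hf ?_⟩
  rw [tensorDualHom_lTensor_lcomp] at hz
  exact hz

theorem DualVanishing.subsingleton_ext (hC : Function.Bijective (LinearMap.lsmul R C))
    (hCC : ∀ j, 1 ≤ j → Subsingleton (ModExt R C C j))
    (hK : DualVanishing (R := R) C K) (j : ℕ) (hj : 1 ≤ j) : Subsingleton (ModExt R K C j) := by
  induction j, hj using Nat.le_induction generalizing K with
  | base =>
    obtain ⟨m, f, hf⟩ := Module.Finite.exists_fin' R K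
    have he := (LinearMap.ker f).injective_subtype
    have hef : Function.Exact (LinearMap.ker f).subtype f := LinearMap.exact_subtype_ker_map f
    have hs := lcomp_surjective_of_subsingleton_ext R he hef hf (hK.ext_ring 1 le_rfl)
    refine subsingleton_ext_one_of_forall_extension C he hef hf
      (subsingleton_ext_of_projective _ C 1 le_rfl) fun φ ↦ ?_
    obtain ⟨y, rfl⟩ := ((hK.ker hC hCC hf).tensorDualHom_bijective hC hCC).2 φ
    obtain ⟨z, rfl⟩ := LinearMap.lTensor_surjective C hs y
    exact ⟨tensorDualHom (R := R) C (Fin m → R) z, (tensorDualHom_lTensor_lcomp C _ z).symm⟩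
  | succ j hj ih =>
    obtain ⟨m, f, hf⟩ := Module.Finite.exists_fin' R K
    have he := (LinearMap.ker f).injective_subtype
    have hef : Function.Exact (LinearMap.ker f).subtype f := LinearMap.exact_subtype_ker_map f
    exact subsingleton_ext_right_of_contravariant C he hef hf j (ih (hK.ker hC hCC hf))
      (subsingleton_ext_of_projective _ C (j + 1) (by omega))

end DualTensor

theorem auslander_reiten_of_finite_C_injdim_dual
    (R : Type) [CommRing R] [IsNoetherianRing R] [IsLocalRing R]
    (C : Type) [AddCommGroup C] [Module R C] [Module.Finite R C]
    (hC : IsSemidualizing R C)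
    (M : Type) [AddCommGroup M] [Module R M] [Module.Finite R M]
    (hCinj : HasFiniteInjDim R (TensorProduct R C (M →ₗ[R] R)))
    (hextR : ∀ i : ℕ, 1 ≤ i → Subsingleton (extMod R i M R))
    (hextM : ∀ i : ℕ, 1 ≤ i → Subsingleton (extMod R i M M)) :
    Module.Free R M := by
  obtain ⟨n, hn⟩ := hCinj
  have hN : ∀ (L : Type) [AddCommGroup L] [Module R L], ∀ j, n < j →
      Subsingleton (ModExt R L (C ⊗[R] (M →ₗ[R] R)) j) := fun L _ _ j hj ↦
    (subsingleton_extMod_iff R L _ j (by omega)).1 (hn L j hj)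
  have hCC : ∀ j, 1 ≤ j → Subsingleton (ModExt R C C j) := fun j hj ↦
    (subsingleton_extMod_iff R C C j hj).1 (hC.ext_vanish j hj)
  have hMR : ∀ j, 1 ≤ j → Subsingleton (ModExt R M R j) := fun j hj ↦
    (subsingleton_extMod_iff R M R j hj).1 (hextR j hj)
  have : Nontrivial C := by
    by_contra h
    rw [not_nontrivial_iff_subsingleton] at h
    exact one_ne_zero (hC.bijective.1 (Subsingleton.elim (LinearMap.lsmul R C 1)
      (LinearMap.lsmul R C 0)))
  have hM : DualVanishing (R := R) C M :=
    ⟨subsingleton_ext_left_semidualizing C _ hC.bijective hCC n hN,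
      mk_flip_surjective_of_lift_applyₗ_injective C _
        (lift_applyₗ_injective C _ hC.bijective hCC n hN), hMR⟩
  exact free_of_subsingleton_ext_residueField_hom C (n + 1) M
    (hM.subsingleton_ext hC.bijective hCC) hMR fun j hj ↦
      subsingleton_ext_of_linearEquiv_right _ (LinearEquiv.ofBijective _
        (hM.tensorDualHom_bijective hC.bijective hCC)) j (hN _ j (by omega))
end
end

section
/- Let R be a Cohen-Macaulay commutative Noetherian local ring of Krull dimension d, and let M and N be nonzero finitely generated R-modules such that N is totally reflexive (G-projective). Suppose that Hom_R(M,N) has finite projective dimension and that Ext_R^i(M,N) = 0 for all 1 ≤ i ≤ d. Then both M and N are free. -/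
open CategoryTheory

noncomputable section

section
open RingTheory.Sequence IsLocalRing Pointwise

theorem CategoryTheory.ProjectiveResolution.subsingleton_ext_iff_exactAt {R : Type} [CommRing R]
    {X : ModuleCat.{0} R} (P : ProjectiveResolution X) (Y : ModuleCat.{0} R) (i : ℕ) :
    Subsingleton (Abelian.Ext X Y (i + 1)) ↔
      (P.complex.linearYonedaObj R Y).ExactAt (i + 1) := by
  rw [HomologicalComplex.exactAt_iff' _ i (i + 1) (i + 2) (by simp) (by simp),
    ShortComplex.moduleCat_exact_iff]
  constructor
  · intro h f hf
    have := (P.extMk_eq_zero_iff f (i + 2) rfl hf i rfl).mp (Subsingleton.elim _ _)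
    exact this
  · intro h
    refine subsingleton_of_forall_eq 0 fun α ↦ ?_
    obtain ⟨f, hf, rfl⟩ := P.extMk_surjective α (i + 2) rfl
    exact (P.extMk_eq_zero_iff f (i + 2) rfl hf i rfl).mpr (h f hf)

theorem subsingleton_extMod_succ_iff {R : Type} [CommRing R] (i : ℕ) (M N : Type)
    [AddCommGroup M] [Module R M] [AddCommGroup N] [Module R N] :
    Subsingleton (extMod R (i + 1) M N) ↔
      Subsingleton (Abelian.Ext (ModuleCat.of R M) (ModuleCat.of R N) (i + 1)) := by
  let P := projectiveResolution (ModuleCat.of R M)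
  rw [P.subsingleton_ext_iff_exactAt, HomologicalComplex.exactAt_iff_isZero_homology,
    ← (P.isoExt (R := R) (i + 1) (ModuleCat.of R N)).isZero_iff,
    ModuleCat.isZero_iff_subsingleton]
  rfl

theorem subsingleton_linearMap_of_subsingleton_extMod_zero {R : Type} [CommRing R] {M N : Type}
    [AddCommGroup M] [Module R M] [AddCommGroup N] [Module R N]
    (h : Subsingleton (extMod R 0 M N)) : Subsingleton (M →ₗ[R] N) := by
  let P := projectiveResolution (ModuleCat.of R M)
  have hP : (P.complex.linearYonedaObj R (ModuleCat.of R N)).ExactAt 0 := by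
    rw [HomologicalComplex.exactAt_iff_isZero_homology,
      ← (P.isoExt (R := R) 0 (ModuleCat.of R N)).isZero_iff, ModuleCat.isZero_iff_subsingleton]
    exact h
  rw [HomologicalComplex.exactAt_iff' _ 0 0 1 (by simp) (by simp),
    ShortComplex.moduleCat_exact_iff] at hP
  refine subsingleton_of_forall_eq 0 fun α ↦ ?_
  let π : P.complex.X 0 ⟶ ModuleCat.of R M := P.π.f 0
  have : Epi π := inferInstanceAs (Epi (P.π.f 0))
  have hπ : P.complex.d 1 0 ≫ π = 0 := P.complex_d_comp_π_f_zero
  have hf : P.complex.d 1 0 ≫ π ≫ ModuleCat.ofHom α = 0 := by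
    rw [← Category.assoc, hπ, Limits.zero_comp]
  obtain ⟨g, hg⟩ := hP (π ≫ ModuleCat.ofHom α) hf
  have h0 : π ≫ ModuleCat.ofHom α = 0 := by
    rw [← hg]
    change ((P.complex.linearYonedaObj R (ModuleCat.of R N)).d 0 0).hom g = 0
    rw [HomologicalComplex.shape _ _ _ (by simp)]
    rfl
  rw [← Limits.comp_zero (f := π), cancel_epi] at h0
  exact congrArg ModuleCat.Hom.hom h0

theorem HasFiniteProjDim.exists_hasProjectiveDimensionLT {R : Type} [CommRing R] {M : Type}
    [AddCommGroup M] [Module R M] (h : HasFiniteProjDim R M) :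
    ∃ n : ℕ, HasProjectiveDimensionLT (ModuleCat.of R M) n := by
  obtain ⟨n, hn⟩ := h
  refine ⟨n + 1, .mk fun i hi Y e ↦ ?_⟩
  obtain ⟨j, rfl⟩ : ∃ j, i = j + 1 := ⟨i - 1, by lia⟩
  have := (subsingleton_extMod_succ_iff j M Y).mp (hn Y (j + 1) hi)
  exact Subsingleton.elim (α := Abelian.Ext (ModuleCat.of R M) (ModuleCat.of R Y) (j + 1)) e 0

/-- If the `Ext` groups from the residue field of a Noetherian local ring into the ring vanish
below the Krull dimension `d`, then there is a regular sequence of length `d` such that the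
quotient by it has a nonzero socle. -/
theorem exists_isWeaklyRegular_and_socle {R : Type} [CommRing R] [IsNoetherianRing R]
    [IsLocalRing R] (d : ℕ) (hd : ringKrullDim R = d)
    (h : ∀ i < d, Subsingleton
      (Abelian.Ext (ModuleCat.of R (R ⧸ maximalIdeal R)) (ModuleCat.of R R) i)) :
    ∃ rs : List R, rs.length = d ∧ IsWeaklyRegular R rs ∧ (∀ r ∈ rs, r ∈ maximalIdeal R) ∧
      ∃ s ∉ Ideal.ofList rs, ∀ a ∈ maximalIdeal R, a * s ∈ Ideal.ofList rs := by
  have hlt : maximalIdeal R • (⊤ : Submodule R R) < ⊤ := by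
    simpa [lt_top_iff_ne_top] using (maximalIdeal.isMaximal R).ne_top
  have hsupp : Module.support R (R ⧸ maximalIdeal R) =
      PrimeSpectrum.zeroLocus (maximalIdeal R) := by
    rw [Module.support_eq_zeroLocus, Ideal.annihilator_quotient]
  obtain ⟨rs, hlen, hmem, hreg⟩ := ModuleCat.exists_isRegular_of_exists_subsingleton_ext
    (maximalIdeal R) d (ModuleCat.of R R) hlt (ModuleCat.of R (R ⧸ maximalIdeal R)) hsupp h
  refine ⟨rs, hlen, hreg.toIsWeaklyRegular, hmem, ?_⟩
  by_contra! hs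
  have hsub : Subsingleton ((R ⧸ maximalIdeal R) →ₗ[R]
      R ⧸ (Ideal.ofList rs • ⊤ : Submodule R R)) := by
    refine subsingleton_of_forall_eq 0 fun f ↦ ?_
    obtain ⟨s, hs'⟩ := Submodule.Quotient.mk_surjective _ (f (Submodule.Quotient.mk 1))
    have key : s ∈ Ideal.ofList rs := by
      by_contra hsn
      obtain ⟨a, ha, has⟩ := hs s hsn
      apply has
      have : (Submodule.Quotient.mk (a * s) :
          R ⧸ (Ideal.ofList rs • ⊤ : Submodule R R)) = 0 := by
        have ha0 : a • (Submodule.Quotient.mk 1 : R ⧸ maximalIdeal R) = 0 := by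
          rw [← Submodule.Quotient.mk_smul, Submodule.Quotient.mk_eq_zero]
          simpa using ha
        rw [← smul_eq_mul, Submodule.Quotient.mk_smul, hs', ← map_smul, ha0, map_zero]
      rw [Submodule.Quotient.mk_eq_zero] at this
      simpa using this
    refine Submodule.linearMap_qext _ (LinearMap.ext_ring ?_)
    change f (Submodule.Quotient.mk 1) = 0
    rw [← hs', Submodule.Quotient.mk_eq_zero]
    simpa using key
  obtain ⟨r, hr, hrreg⟩ := IsSMulRegular.subsingleton_linearMap_iff.mp hsub
  rw [Ideal.annihilator_quotient] at hr
  have hreg' : IsWeaklyRegular R (rs ++ [r]) := by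
    rw [isWeaklyRegular_append_iff, isWeaklyRegular_singleton_iff]
    exact ⟨hreg.toIsWeaklyRegular, hrreg⟩
  have hreg'' : IsRegular R (rs ++ [r]) :=
    .of_isWeaklyRegular_of_mem_maximalIdeal R
      (fun x hx ↦ (List.mem_append.mp hx).elim (hmem x) fun hx ↦ List.mem_singleton.mp hx ▸ hr)
      hreg'
  have := ringKrullDim_add_length_eq_ringKrullDim_of_isRegular _ hreg''
  have hnn : 0 ≤ ringKrullDim (R ⧸ Ideal.ofList (rs ++ [r])) := by
    have : Nontrivial (R ⧸ Ideal.ofList (rs ++ [r])) :=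
      Ideal.Quotient.nontrivial_iff.mpr (by simpa using hreg''.top_ne_smul.symm)
    exact ringKrullDim_nonneg_of_nontrivial
  rw [hd] at this
  have h2 : ((d + 1 : ℕ) : WithBot ℕ∞) ≤ (d : ℕ) := by
    rw [← this]
    simpa [hlen] using le_add_of_nonneg_left hnn
  norm_cast at h2
  lia

section
variable {R : Type} [CommRing R] {M Y : Type} [AddCommGroup M] [Module R M]
  [AddCommGroup Y] [Module R Y]

theorem LinearMap.mem_smul_top_of_isSMulRegular {x : R} (hx : IsSMulRegular Y x) (f : M →ₗ[R] Y)
    (hf : ∀ m, f m ∈ x • (⊤ : Submodule R Y)) : f ∈ x • (⊤ : Submodule R (M →ₗ[R] Y)) := by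
  have hf' (m : M) : f m ∈ LinearMap.range (LinearMap.lsmul R Y x) := by
    obtain ⟨y, -, hy⟩ := (Submodule.mem_smul_pointwise_iff_exists _ _ _).mp (hf m)
    exact ⟨y, hy⟩
  let e := LinearEquiv.ofInjective (LinearMap.lsmul R Y x) hx
  refine (Submodule.mem_smul_pointwise_iff_exists _ _ _).mpr
    ⟨e.symm.toLinearMap ∘ₗ f.codRestrict _ hf', trivial, LinearMap.ext fun m ↦ ?_⟩
  exact congrArg Subtype.val (e.apply_symm_apply (f.codRestrict _ hf' m))

theorem LinearMap.exists_lift_quotSMulTop {x : R} (hx : IsSMulRegular Y x)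
    (h : Subsingleton (Abelian.Ext (ModuleCat.of R M) (ModuleCat.of R Y) 1))
    (g : M →ₗ[R] QuotSMulTop x Y) :
    ∃ f : M →ₗ[R] Y, (Submodule.mkQ _) ∘ₗ f = g := by
  have hS : ((ModuleCat.of R Y).smulShortComplex x).ShortExact :=
    IsSMulRegular.smulShortComplex_shortExact hx
  obtain ⟨a, ha⟩ := Abelian.Ext.covariant_sequence_exact₃ (ModuleCat.of R M) hS
    (Abelian.Ext.mk₀ (ModuleCat.ofHom g)) (zero_add 1)
    (@Subsingleton.elim _ h _ _)
  obtain ⟨f, rfl⟩ := (Abelian.Ext.mk₀_bijective _ _).2 a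
  rw [Abelian.Ext.mk₀_comp_mk₀] at ha
  exact ⟨f.hom, congrArg ModuleCat.Hom.hom ((Abelian.Ext.mk₀_bijective _ _).1 ha)⟩

theorem subsingleton_ext_quotSMulTop {x : R} (hx : IsSMulRegular Y x) (i : ℕ)
    (h : Subsingleton (Abelian.Ext (ModuleCat.of R M) (ModuleCat.of R Y) i))
    (h' : Subsingleton (Abelian.Ext (ModuleCat.of R M) (ModuleCat.of R Y) (i + 1))) :
    Subsingleton (Abelian.Ext (ModuleCat.of R M) (ModuleCat.of R (QuotSMulTop x Y)) i) := by
  have hS : ((ModuleCat.of R Y).smulShortComplex x).ShortExact :=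
    IsSMulRegular.smulShortComplex_shortExact hx
  refine subsingleton_of_forall_eq 0 fun b ↦ ?_
  obtain ⟨a, rfl⟩ := Abelian.Ext.covariant_sequence_exact₃ (ModuleCat.of R M) hS b rfl
    (@Subsingleton.elim _ h' _ _)
  have ha : a = 0 := @Subsingleton.elim _ h a 0
  subst ha
  exact Abelian.Ext.zero_comp (C := ModuleCat R) _ _ _ _ _

theorem Submodule.map_ideal_smul_top {F G : Type} [AddCommGroup F] [Module R F] [AddCommGroup G]
    [Module R G] (I : Ideal R) {f : F →ₗ[R] G} (hf : Function.Surjective f) :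
    (I • (⊤ : Submodule R F)).map f = I • ⊤ := by
  rw [Submodule.map_smul'', Submodule.map_top, LinearMap.range_eq_top.mpr hf]

/-- Reducing modulo a `Y`-regular sequence commutes with `Hom(M, -)` when enough `Ext` groups
vanish. -/
theorem isWeaklyRegular_linearMap_and_lift {rs : List R} (hrs : IsWeaklyRegular Y rs)
    (h : ∀ i, 1 ≤ i → i ≤ rs.length →
      Subsingleton (Abelian.Ext (ModuleCat.of R M) (ModuleCat.of R Y) i)) :
    IsWeaklyRegular (M →ₗ[R] Y) rs ∧
      (∀ g : M →ₗ[R] Y ⧸ (Ideal.ofList rs • (⊤ : Submodule R Y)),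
        ∃ f : M →ₗ[R] Y, (Submodule.mkQ _) ∘ₗ f = g) ∧
      ∀ f : M →ₗ[R] Y, (∀ m, f m ∈ Ideal.ofList rs • (⊤ : Submodule R Y)) →
        f ∈ Ideal.ofList rs • (⊤ : Submodule R (M →ₗ[R] Y)) := by
  induction rs generalizing Y with
  | nil =>
    refine ⟨.nil R (M →ₗ[R] Y), fun g ↦ ?_, fun f hf ↦ ?_⟩
    · let e := Submodule.quotEquivOfEqBot (Ideal.ofList ([] : List R) • (⊤ : Submodule R Y))
        (by rw [Ideal.ofList_nil, Submodule.bot_smul])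
      refine ⟨e.toLinearMap ∘ₗ g, LinearMap.ext fun m ↦ ?_⟩
      exact e.symm_apply_apply (g m)
    · have : f = 0 := LinearMap.ext fun m ↦ by simpa using hf m
      simp [this]
  | cons x xs ih =>
    obtain ⟨hx, hxs⟩ := (isWeaklyRegular_cons_iff _ _ _).mp hrs
    obtain ⟨ihW, ihS, ihK⟩ := ih hxs fun i hi hi' ↦ subsingleton_ext_quotSMulTop hx i
      (h i hi (by simp; lia)) (h (i + 1) (by lia) (by simp; lia))
    let π : Y →ₗ[R] QuotSMulTop x Y := Submodule.mkQ _
    let Φ : (M →ₗ[R] Y) →ₗ[R] (M →ₗ[R] QuotSMulTop x Y) := π.compRight R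
    have hΦ : Function.Surjective Φ :=
      LinearMap.exists_lift_quotSMulTop hx (h 1 le_rfl (by simp))
    have hker : LinearMap.ker Φ = x • ⊤ := by
      refine le_antisymm (fun f hf ↦ ?_) ?_
      · refine LinearMap.mem_smul_top_of_isSMulRegular hx f fun m ↦ ?_
        exact (Submodule.Quotient.mk_eq_zero _).mp (LinearMap.congr_fun hf m)
      · rintro _ ⟨f, -, rfl⟩
        refine LinearMap.ext fun m ↦ (Submodule.Quotient.mk_eq_zero _).mpr ?_
        exact Submodule.smul_mem_pointwise_smul (f m) x ⊤ trivial
    refine ⟨?_, fun g ↦ ?_, fun f hf ↦ ?_⟩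
    · refine (isWeaklyRegular_cons_iff _ _ _).mpr ⟨fun f g hfg ↦ ?_, ?_⟩
      · exact LinearMap.ext fun m ↦ hx (LinearMap.congr_fun hfg m)
      · let e : QuotSMulTop x (M →ₗ[R] Y) ≃ₗ[R] (M →ₗ[R] QuotSMulTop x Y) :=
          Submodule.quotEquivOfEq _ _ hker.symm ≪≫ₗ Φ.quotKerEquivOfSurjective hΦ
        exact (e.isWeaklyRegular_congr xs).mpr ihW
    · let e := Submodule.quotOfListConsSMulTopEquivQuotSMulTopInner Y x xs
      obtain ⟨g', hg'⟩ := ihS (e.toLinearMap ∘ₗ g)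
      obtain ⟨f, rfl⟩ := hΦ g'
      refine ⟨f, LinearMap.ext fun m ↦ e.injective ?_⟩
      exact LinearMap.congr_fun hg' m
    · rw [Ideal.ofList_cons_smul, sup_comm, ← hker, ← Submodule.comap_map_eq,
        Submodule.map_ideal_smul_top _ hΦ]
      refine ihK _ fun m ↦ ?_
      rw [← Submodule.map_ideal_smul_top _ (Submodule.mkQ_surjective _)]
      have hm := hf m
      rw [Ideal.ofList_cons_smul, sup_comm, ← Submodule.ker_mkQ (x • ⊤),
        ← Submodule.comap_map_eq] at hm
      exact hm
end

section
variable {R : Type} [CommRing R]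

theorem RingTheory.Sequence.IsWeaklyRegular.of_shortExact {K F H : Type}
    [AddCommGroup K] [Module R K] [AddCommGroup F] [Module R F] [AddCommGroup H] [Module R H]
    {rs : List R}
    (hF : IsWeaklyRegular F rs) (hH : IsWeaklyRegular H rs) {f : K →ₗ[R] F} {g : F →ₗ[R] H}
    (hf : Function.Injective f) (hfg : Function.Exact f g) (hg : Function.Surjective g) :
    IsWeaklyRegular K rs := by
  induction rs generalizing K F H with
  | nil => exact .nil R K
  | cons x xs ih =>
    obtain ⟨hFx, hFxs⟩ := (isWeaklyRegular_cons_iff _ _ _).mp hF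
    obtain ⟨hHx, hHxs⟩ := (isWeaklyRegular_cons_iff _ _ _).mp hH
    refine (isWeaklyRegular_cons_iff _ _ _).mpr ⟨hFx.of_injective f hf, ih hFxs hHxs
      (f := QuotSMulTop.map x f) (g := QuotSMulTop.map x g) ?_ (QuotSMulTop.map_exact x hfg hg)
      (QuotSMulTop.map_surjective x hg)⟩
    have h := QuotSMulTop.map_first_exact_on_four_term_exact_of_isSMulRegular_last
      (f₁ := (0 : K →ₗ[R] K)) ((LinearMap.exact_zero_iff_injective K f).mpr hf) hfg hHx
    rw [map_zero] at h
    exact (LinearMap.exact_zero_iff_injective _ _).mp h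

theorem mem_ideal_smul_top_of_forall_mem {ι : Type} [Finite ι] (I : Ideal R) (f : ι → R)
    (hf : ∀ i, f i ∈ I) : f ∈ I • (⊤ : Submodule R (ι → R)) := by
  classical
  cases nonempty_fintype ι
  rw [pi_eq_sum_univ' f]
  exact sum_mem fun i _ ↦ Submodule.smul_mem_smul (hf i) trivial

theorem forall_mem_of_mem_ideal_smul_top {ι : Type} (I : Ideal R) {f : ι → R}
    (hf : f ∈ I • (⊤ : Submodule R (ι → R))) (i : ι) : f i ∈ I := by
  have := Submodule.mem_map_of_mem (f := LinearMap.proj (R := R) (φ := fun _ : ι ↦ R) i) hf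
  rw [Submodule.map_smul''] at this
  simpa using (Submodule.smul_mono le_rfl le_top : _ ≤ I • (⊤ : Submodule R R)) this

/-- Every finite module over a local ring has a minimal free cover. -/
theorem IsLocalRing.exists_surjective_ker_le [IsLocalRing R] (M : Type) [AddCommGroup M]
    [Module R M] [Module.Finite R M] : ∃ (ι : Type) (_ : Fintype ι) (p : (ι → R) →ₗ[R] M),
      Function.Surjective p ∧ LinearMap.ker p ≤ maximalIdeal R • ⊤ := by
  let w := Module.Free.chooseBasis (ResidueField R) (TensorProduct R (ResidueField R) M)
  obtain ⟨v, hv⟩ :=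
    (TensorProduct.mk_surjective R M (ResidueField R) Ideal.Quotient.mk_surjective).comp_left w
  have hv' (i) : TensorProduct.mk R (ResidueField R) M 1 (v i) = w i := congr_fun hv i
  refine ⟨_, inferInstance, Fintype.linearCombination R v, ?_, fun c hc ↦ ?_⟩
  · rw [← LinearMap.range_eq_top, Fintype.range_linearCombination]
    exact span_eq_top_of_tmul_eq_basis v w hv'
  · refine mem_ideal_smul_top_of_forall_mem _ _ fun i ↦ ?_
    rw [LinearMap.mem_ker, Fintype.linearCombination_apply] at hc
    have h := congrArg (TensorProduct.mk R (ResidueField R) M 1) hc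
    rw [map_sum, map_zero] at h
    have h' : ∑ i, residue R (c i) • w i = 0 := by
      rw [← h]
      refine Finset.sum_congr rfl fun i _ ↦ ?_
      rw [map_smul, hv']
      exact (algebraMap_smul (ResidueField R) (c i) (w i))
    exact (residue_eq_zero_iff _).mp (Fintype.linearIndependent_iff.mp w.linearIndependent _ h' i)

variable [IsNoetherianRing R] [IsLocalRing R]

/-- A finite module of finite projective dimension is free if it has a regular sequence which is
`R`-regular and modulo which `R` has a nonzero socle. -/
theorem Module.free_of_hasProjectiveDimensionLT_of_isWeaklyRegular {rs : List R}
    (hrs : IsWeaklyRegular R rs) {s : R} (hs : s ∉ Ideal.ofList rs)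
    (hs' : ∀ a ∈ maximalIdeal R, a * s ∈ Ideal.ofList rs)
    (n : ℕ) {H : Type} [AddCommGroup H] [Module R H] [Module.Finite R H]
    (hH : IsWeaklyRegular H rs) (hn : HasProjectiveDimensionLT (ModuleCat.of R H) n) :
    Module.Free R H := by
  induction n generalizing H with
  | zero =>
    have := ModuleCat.isZero_iff_subsingleton.mp
      (isZero_of_hasProjectiveDimensionLT_zero (ModuleCat.of R H))
    have : Subsingleton H := this
    exact Module.Free.of_subsingleton R H
  | succ n ih =>
    rcases n with _ | n
    · have : CategoryTheory.Projective (ModuleCat.of R H) := inferInstance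
      have := (IsProjective.iff_projective (R := R) H).mpr this
      exact Module.free_of_flat_of_isLocalRing
    · obtain ⟨ι, _, p, hp, hker⟩ := IsLocalRing.exists_surjective_ker_le (R := R) H
      let K := LinearMap.ker p
      have hF : IsWeaklyRegular (ι → R) rs :=
        (TensorProduct.rid R _).isWeaklyRegular_congr rs |>.mp
          (hrs.isWeaklyRegular_lTensor (M₂ := ι → R))
      have hK : IsWeaklyRegular K rs :=
        hF.of_shortExact hH K.subtype_injective (LinearMap.exact_subtype_ker_map p) hp
      have hS := LinearMap.shortExact_shortComplexKer hp
      have hFproj : CategoryTheory.Projective (ModuleCat.of R (ι → R)) :=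
        (IsProjective.iff_projective (R := R) _).mp inferInstance
      have : Module.Free R K := ih hK (hS.hasProjectiveDimensionLT_X₁ (n + 1)
        (inferInstanceAs (HasProjectiveDimensionLT (ModuleCat.of R (ι → R)) _)) hn)
      have hinj := map_first_exact_on_four_term_right_exact_of_isSMulRegular_last
        (f₁ := (0 : K →ₗ[R] K))
        ((LinearMap.exact_zero_iff_injective K K.subtype).mpr K.subtype_injective)
        (LinearMap.exact_subtype_ker_map p) hp hH
      have hK0 : Subsingleton K := by
        let b := Module.Free.chooseBasis R K
        rcases isEmpty_or_nonempty (Module.Free.ChooseBasisIndex R K) with h | ⟨⟨i⟩⟩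
        · exact b.repr.toEquiv.subsingleton
        · exfalso
          have h1 : s • (b i : ι → R) ∈ Ideal.ofList rs • (⊤ : Submodule R (ι → R)) := by
            refine mem_ideal_smul_top_of_forall_mem _ _ fun j ↦ ?_
            rw [Pi.smul_apply, smul_eq_mul, mul_comm]
            exact hs' _ (forall_mem_of_mem_ideal_smul_top _ (hker (b i).2) j)
          have h2 : (Submodule.Quotient.mk (s • b i) :
              K ⧸ (Ideal.ofList rs • ⊤ : Submodule R K)) = 0 := by
            obtain ⟨y, hy⟩ := (hinj (Submodule.Quotient.mk (s • b i))).mp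
              ((Submodule.Quotient.mk_eq_zero _).mpr h1)
            obtain ⟨y, rfl⟩ := Submodule.Quotient.mk_surjective _ y
            rw [← hy]
            rfl
          rw [Submodule.Quotient.mk_eq_zero] at h2
          have h3 := Submodule.mem_map_of_mem (f := b.coord i) h2
          rw [Submodule.map_smul''] at h3
          have h4 : _ ∈ Ideal.ofList rs • (⊤ : Submodule R R) :=
            Submodule.smul_mono le_rfl le_top h3
          apply hs
          simpa using h4
      have hinj' : Function.Injective p :=
        LinearMap.ker_eq_bot.mp (Submodule.subsingleton_iff_eq_bot.mp hK0)
      exact Module.Free.of_equiv (LinearEquiv.ofBijective p ⟨hinj', hp⟩)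

end

section
variable {R : Type} [CommRing R] [IsLocalRing R]

theorem LinearMap.injective_of_ker_le_maximalIdeal_smul {F X : Type} [AddCommGroup F]
    [Module R F] [Module.Finite R F] [AddCommGroup X] [Module R X] [Module.Projective R X]
    {p : F →ₗ[R] X}
    (hp : Function.Surjective p) (hker : LinearMap.ker p ≤ maximalIdeal R • ⊤) :
    Function.Injective p := by
  obtain ⟨σ, hσ⟩ := Module.projective_lifting_property p LinearMap.id hp
  have hσ' (x : X) : p (σ x) = x := LinearMap.congr_fun hσ x
  have htop : LinearMap.range σ = ⊤ := by
    refine top_le_iff.mp (Submodule.le_of_le_smul_of_le_jacobson_bot Module.Finite.fg_top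
      (maximalIdeal_le_jacobson _) fun x _ ↦ ?_)
    rw [← sub_add_cancel x (σ (p x)), add_comm]
    exact Submodule.add_mem_sup ⟨_, rfl⟩ (hker (by simp [hσ']))
  have : Function.Surjective σ := LinearMap.range_eq_top.mp htop
  exact (Function.LeftInverse.rightInverse_of_surjective hσ' this).injective

theorem Module.free_of_free_tensorProduct {M L : Type} [AddCommGroup M] [Module R M]
    [AddCommGroup L] [Module R L] [Module.Finite R M] [Module.Finite R L] [Nontrivial L]
    [Module.Free R (TensorProduct R M L)] : Module.Free R M := by
  obtain ⟨ι, _, p, hp, hpk⟩ := IsLocalRing.exists_surjective_ker_le (R := R) M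
  obtain ⟨κ, _, q, hq, hqk⟩ := IsLocalRing.exists_surjective_ker_le (R := R) L
  have hinj : Function.Injective (TensorProduct.map p q) := by
    refine LinearMap.injective_of_ker_le_maximalIdeal_smul (TensorProduct.map_surjective hp hq) ?_
    rw [TensorProduct.map_ker (LinearMap.exact_subtype_ker_map p) hp
      (LinearMap.exact_subtype_ker_map q) hq]
    refine sup_le ?_ ?_
    · rintro _ ⟨t, rfl⟩
      induction t with
      | zero => simp
      | add a b ha hb => rw [map_add]; exact add_mem ha hb
      | tmul v w =>
        have := Submodule.mem_map_of_mem (f := TensorProduct.mk R (ι → R) (κ → R) v) (hqk w.2)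
        rw [Submodule.map_smul''] at this
        exact Submodule.smul_mono le_rfl le_top this
    · rintro _ ⟨t, rfl⟩
      induction t with
      | zero => simp
      | add a b ha hb => rw [map_add]; exact add_mem ha hb
      | tmul v w =>
        have := Submodule.mem_map_of_mem (f := (TensorProduct.mk R (ι → R) (κ → R)).flip w)
          (hpk v.2)
        rw [Submodule.map_smul''] at this
        exact Submodule.smul_mono le_rfl le_top this
  have : Nonempty κ := by
    by_contra! h
    exact not_subsingleton L hq.subsingleton
  classical
  obtain ⟨j⟩ := this
  refine Module.Free.of_equiv (LinearEquiv.ofBijective p ⟨?_, hp⟩)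
  rw [← LinearMap.ker_eq_bot, LinearMap.ker_eq_bot']
  intro v hv
  have h0 : v ⊗ₜ[R] (Pi.single j 1 : κ → R) = 0 := hinj (by simp [hv])
  simpa using congrArg ((TensorProduct.rid R (ι → R)).toLinearMap ∘ₗ
    TensorProduct.map LinearMap.id (LinearMap.proj (R := R) (φ := fun _ : κ ↦ R) j)) h0

theorem IsLocalRing.exists_linearMap_ne_zero {I : Submodule R R} {s : R} (hs : s ∉ I)
    (hs' : ∀ a ∈ maximalIdeal R, a * s ∈ I) (C : Type) [AddCommGroup C] [Module R C]
    [Module.Finite R C] [Nontrivial C] : ∃ g : C →ₗ[R] R ⧸ I, g ≠ 0 := by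
  obtain ⟨P, hP, -⟩ := (eq_top_or_exists_le_coatom (⊥ : Submodule R C)).resolve_left bot_ne_top
  have : IsSimpleModule R (C ⧸ P) := isSimpleModule_iff_isCoatom.mpr hP
  obtain ⟨J, hJ, ⟨e⟩⟩ := isSimpleModule_iff_quot_maximal.mp this
  obtain rfl := eq_maximalIdeal hJ
  let t : R ⧸ maximalIdeal R →ₗ[R] R ⧸ I :=
    Submodule.liftQ _ (LinearMap.toSpanSingleton R _ (I.mkQ s)) fun a ha ↦ by
      rw [LinearMap.mem_ker, LinearMap.toSpanSingleton_apply, ← map_smul]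
      exact (Submodule.Quotient.mk_eq_zero _).mpr (hs' a ha)
  refine ⟨t ∘ₗ e.toLinearMap ∘ₗ P.mkQ, fun h ↦ hs ?_⟩
  obtain ⟨c, hc⟩ := (e.surjective.comp P.mkQ_surjective) (Submodule.Quotient.mk 1)
  have h1 : t (Submodule.Quotient.mk 1) = 0 := by
    rw [← hc]; exact LinearMap.congr_fun h c
  have h2 : I.mkQ s = 0 := by
    rw [← h1]; exact (one_smul R _).symm
  exact (Submodule.Quotient.mk_eq_zero _).mp h2

/-- A finite module with free dual is free if its dual is compatible with reduction modulo an ideal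
`I` such that `R ⧸ I` has a nonzero socle. -/
theorem Module.free_of_free_dual [IsNoetherianRing R] {I : Ideal R} {s : R} (hs : s ∉ I)
    (hs' : ∀ a ∈ maximalIdeal R, a * s ∈ I) {X : Type} [AddCommGroup X] [Module R X]
    [Module.Finite R X] [Module.Free R (X →ₗ[R] R)]
    (hlift : ∀ g : X →ₗ[R] R ⧸ I, ∃ f : X →ₗ[R] R, Submodule.mkQ I ∘ₗ f = g)
    (hmem : ∀ f : X →ₗ[R] R, (∀ x, f x ∈ I) → f ∈ I • (⊤ : Submodule R (X →ₗ[R] R))) :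
    Module.Free R X := by
  classical
  let φ := Module.Free.chooseBasis R (X →ₗ[R] R)
  let Φ : X →ₗ[R] (Module.Free.ChooseBasisIndex R (X →ₗ[R] R) → R) := LinearMap.pi φ
  have hsurj : Function.Surjective Φ := by
    rw [← LinearMap.range_eq_top]
    by_contra hne
    have : Nontrivial (_ ⧸ LinearMap.range Φ) := Submodule.Quotient.nontrivial_iff.mpr hne
    obtain ⟨g, hg⟩ := IsLocalRing.exists_linearMap_ne_zero hs hs' (_ ⧸ LinearMap.range Φ)
    let h := g ∘ₗ (LinearMap.range Φ).mkQ
    choose a ha using fun i ↦ Submodule.mkQ_surjective I (h (Pi.single i 1))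
    have hfh (v) : Submodule.mkQ I (∑ i, a i * v i) = h v := by
      conv_rhs => rw [pi_eq_sum_univ' v]
      simp only [map_sum, map_smul, ← ha]
      simp only [← map_smul, smul_eq_mul, mul_comm]
    have hf := hmem (∑ i, a i • φ i) fun x ↦ by
      rw [← Submodule.ker_mkQ I, LinearMap.mem_ker]
      have := hfh (Φ x)
      have h0 : h (Φ x) = 0 := by
        have : (LinearMap.range Φ).mkQ (Φ x) = 0 := by simp
        rw [LinearMap.comp_apply, this, map_zero]
      rw [h0] at this
      rw [← this]
      simp [Φ]
    have hai (i) : a i ∈ I := by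
      have := Submodule.mem_map_of_mem (f := φ.coord i) hf
      rw [Submodule.map_smul''] at this
      have h4 := (Submodule.smul_mono le_rfl le_top : _ ≤ I • (⊤ : Submodule R R)) this
      simpa [Finsupp.single_apply] using h4
    apply hg
    refine Submodule.linearMap_qext _ (LinearMap.ext fun v ↦ ?_)
    change h v = 0
    rw [← hfh]
    exact (Submodule.Quotient.mk_eq_zero _).mpr (sum_mem fun i _ ↦ I.mul_mem_right _ (hai i))
  obtain ⟨σ, hσ⟩ := Module.projective_lifting_property Φ LinearMap.id hsurj
  have hσ' (v) : Φ (σ v) = v := LinearMap.congr_fun hσ v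
  refine Module.Free.of_equiv (LinearEquiv.ofBijective Φ ⟨?_, hsurj⟩).symm
  rw [← LinearMap.ker_eq_bot, ← Submodule.subsingleton_iff_eq_bot]
  by_contra hK
  rw [not_subsingleton_iff_nontrivial] at hK
  obtain ⟨g, hg⟩ := IsLocalRing.exists_linearMap_ne_zero hs hs' (LinearMap.ker Φ)
  let π : X →ₗ[R] LinearMap.ker Φ :=
    (LinearMap.id - σ ∘ₗ Φ).codRestrict _ fun x ↦ by simp [hσ']
  obtain ⟨f, hf⟩ := hlift (g ∘ₗ π)
  refine hg (LinearMap.ext fun k ↦ ?_)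
  have hk : Φ k = 0 := k.2
  have hπ : π k = k := Subtype.ext (by simp [π, hk])
  have hfk : f k = 0 := by
    rw [← φ.sum_repr f, LinearMap.sum_apply]
    refine Finset.sum_eq_zero fun i _ ↦ ?_
    rw [LinearMap.smul_apply, show φ i k = 0 from congrFun hk i, smul_zero]
  rw [← hπ]
  refine (LinearMap.congr_fun hf k).symm.trans ?_
  simp [hfk]
end

end

theorem subsingleton_ext_of_linearEquiv {R : Type} [CommRing R] {M N Y : Type} [AddCommGroup M]
    [Module R M] [AddCommGroup N] [Module R N] [AddCommGroup Y] [Module R Y] (e : N ≃ₗ[R] Y)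
    {i : ℕ} (h : Subsingleton (Abelian.Ext (ModuleCat.of R M) (ModuleCat.of R N) i)) :
    Subsingleton (Abelian.Ext (ModuleCat.of R M) (ModuleCat.of R Y) i) := by
  refine subsingleton_of_forall_eq 0 fun x ↦ ?_
  have h0 : x.comp (Abelian.Ext.mk₀ e.toModuleIso.inv) (add_zero i) = 0 :=
    @Subsingleton.elim _ h _ _
  calc x = (x.comp (Abelian.Ext.mk₀ e.toModuleIso.inv) (add_zero i)).comp
        (Abelian.Ext.mk₀ e.toModuleIso.hom) (add_zero i) := by
          rw [Abelian.Ext.comp_assoc_of_third_deg_zero, Abelian.Ext.mk₀_comp_mk₀, Iso.inv_hom_id,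
            Abelian.Ext.comp_mk₀_id]
    _ = 0 := by rw [h0, Abelian.Ext.zero_comp]

theorem free_of_totally_reflexive_and_finite_pd_hom
    (R : Type) [CommRing R] [IsNoetherianRing R] [IsLocalRing R]
    (d : ℕ) (hd : ringKrullDim R = d) (hCM : moduleDepth R R = d)
    (M N : Type) [AddCommGroup M] [Module R M] [AddCommGroup N] [Module R N]
    [Module.Finite R M] [Module.Finite R N] [Nontrivial M] [Nontrivial N]
    (hrefl : Function.Bijective (Module.Dual.eval R N))
    (hextN : ∀ i : ℕ, 1 ≤ i → Subsingleton (extMod R i N R))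
    (hextNdual : ∀ i : ℕ, 1 ≤ i → Subsingleton (extMod R i (N →ₗ[R] R) R))
    (hproj : HasFiniteProjDim R (M →ₗ[R] N))
    (hext : ∀ i : ℕ, 1 ≤ i → i ≤ d → Subsingleton (extMod R i M N)) :
    Module.Free R M ∧ Module.Free R N := by
  have hk (i : ℕ) (hi : i < d) : Subsingleton (Abelian.Ext
      (ModuleCat.of R (R ⧸ IsLocalRing.maximalIdeal R)) (ModuleCat.of R R) i) := by
    have h : Subsingleton (extMod R i (R ⧸ IsLocalRing.maximalIdeal R) R) :=
      not_not.mp (Nat.notMem_of_lt_sInf (hCM ▸ hi : i < moduleDepth R R))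
    cases i with
    | zero =>
      have := subsingleton_linearMap_of_subsingleton_extMod_zero h
      exact (Abelian.Ext.addEquiv₀.trans ModuleCat.homAddEquiv).subsingleton
    | succ i => exact (subsingleton_extMod_succ_iff i _ _).mp h
  obtain ⟨rs, rfl, hreg, -, s, hs, hs'⟩ := exists_isWeaklyRegular_and_socle d hd hk
  let I : Ideal R := Ideal.ofList rs
  have hI : (Ideal.ofList rs • ⊤ : Submodule R R) = I := by simp [I]
  let e : N ≃ₗ[R] Module.Dual R (N →ₗ[R] R) := LinearEquiv.ofBijective _ hrefl
  obtain ⟨hW₁, hS₁, hK₁⟩ := isWeaklyRegular_linearMap_and_lift (M := N →ₗ[R] R) hreg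
    fun i hi _ ↦ by
      obtain ⟨i, rfl⟩ := Nat.exists_eq_add_of_le' hi
      exact (subsingleton_extMod_succ_iff i _ _).mp (hextNdual _ hi)
  rw [hI] at hS₁ hK₁
  obtain ⟨hW₂, hS₂, hK₂⟩ := isWeaklyRegular_linearMap_and_lift (M := M) hW₁
    fun i hi hi' ↦ by
      obtain ⟨i, rfl⟩ := Nat.exists_eq_add_of_le' hi
      exact subsingleton_ext_of_linearEquiv e
        ((subsingleton_extMod_succ_iff i _ _).mp (hext _ hi hi'))
  obtain ⟨n, hn⟩ := hproj.exists_hasProjectiveDimensionLT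
  have hfree : Module.Free R (M →ₗ[R] (N →ₗ[R] R) →ₗ[R] R) :=
    Module.free_of_hasProjectiveDimensionLT_of_isWeaklyRegular hreg hs hs' n hW₂
      (hasProjectiveDimensionLT_of_iso (LinearEquiv.congrRight e).toModuleIso n)
  let t := TensorProduct.lift.equiv (RingHom.id R) M (N →ₗ[R] R) R
  have : Module.Free R (TensorProduct R M (N →ₗ[R] R) →ₗ[R] R) := Module.Free.of_equiv t
  have : Module.Free R (TensorProduct R M (N →ₗ[R] R)) := by
    refine Module.free_of_free_dual hs hs' (fun g ↦ ?_) fun f hf ↦ ?_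
    · let ρ : ((N →ₗ[R] R) →ₗ[R] R) →ₗ[R] (N →ₗ[R] R) →ₗ[R] R ⧸ I :=
        (Submodule.mkQ I).compRight R
      have hρ : LinearMap.ker ρ = I • ⊤ := by
        refine le_antisymm (fun f hf ↦ hK₁ f fun m ↦ ?_) ?_
        · exact (Submodule.Quotient.mk_eq_zero _).mp (LinearMap.congr_fun hf m)
        · refine Submodule.smul_le.mpr fun a ha f _ ↦ LinearMap.ext fun m ↦ ?_
          exact (Submodule.Quotient.mk_eq_zero _).mpr (I.mul_mem_right _ ha)
      let ε := Submodule.quotEquivOfEq _ _ hρ.symm ≪≫ₗ ρ.quotKerEquivOfSurjective hS₁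
      obtain ⟨f, hf⟩ := hS₂ (ε.symm.toLinearMap ∘ₗ TensorProduct.curry g)
      refine ⟨t f, TensorProduct.ext' fun m v ↦ ?_⟩
      have h : ε (Submodule.Quotient.mk (f m)) = TensorProduct.curry g m := by
        rw [← LinearEquiv.eq_symm_apply]
        exact LinearMap.congr_fun hf m
      exact LinearMap.congr_fun h v
    · have h := hK₂ (t.symm f) fun m ↦ hK₁ _ fun v ↦ hf (m ⊗ₜ v)
      have h' := Submodule.mem_map_of_mem (f := t.toLinearMap) h
      rw [Submodule.map_smul''] at h'
      simpa using Submodule.smul_mono le_rfl le_top h'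
  have : Nontrivial (N →ₗ[R] R) := by
    by_contra h
    rw [not_nontrivial_iff_subsingleton] at h
    exact not_subsingleton N (e.toEquiv.subsingleton)
  refine ⟨Module.free_of_free_tensorProduct (L := N →ₗ[R] R), ?_⟩
  have : Module.Free R (TensorProduct R (N →ₗ[R] R) M) :=
    Module.Free.of_equiv (TensorProduct.comm R M (N →ₗ[R] R))
  have : Module.Free R (N →ₗ[R] R) := Module.free_of_free_tensorProduct (L := M)
  exact Module.Free.of_equiv e.symm
end
end
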